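/- There is an absolute constant c such that for every connected graph G on n vertices and every two labelled spanning trees T1 = (B1, l1) and T2 = (B2, l2) of G satisfying the condition that for every label i the edges l1⁻¹(i) and l2⁻¹(i) lie in the same 2-connected component of G, the labelled spanning tree T1 can be reconfigured to T2 using at most c·n·log n basis exchange steps. -/

import Mathlib

open Set Function

universe u

/-- `StepsIn step n a b` means that `b` can be obtained from `a` by exactly `n` steps. -/
def StepsIn {X : Type*} (step : X → X → Prop) : ℕ → X → X → Prop
  | 0, a, b => a = b
  | n + 1, a, b => ∃ c, step a c ∧ StepsIn step n c b

variable {V : Type u}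

/-- `B` is the edge set of a spanning tree of `G`. -/
def IsSpanningTreeOf (G : SimpleGraph V) (B : Set (Sym2 V)) : Prop :=
  B ⊆ G.edgeSet ∧ (SimpleGraph.fromEdgeSet B).IsTree

/-- A labelled spanning tree of a graph `G` on `n` vertices, encoded as the injective map
sending each label `i ∈ {1, …, n-1}` to the edge carrying that label; its range must be
the edge set of a spanning tree of `G`. -/
def IsLabelledSpanningTree [Fintype V] (G : SimpleGraph V)
    (b : Fin (Fintype.card V - 1) → Sym2 V) : Prop :=
  Function.Injective b ∧ IsSpanningTreeOf G (Set.range b)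

/-- One basis exchange step between labelled spanning trees: the edge carrying label `i`
is replaced by an edge `f` of `G` not in the current tree, `f` receives label `i`, and the
result is again a spanning tree.  All other labels are unchanged. -/
def TreeStep [Fintype V] (G : SimpleGraph V)
    (b b' : Fin (Fintype.card V - 1) → Sym2 V) : Prop :=
  ∃ (i : Fin (Fintype.card V - 1)) (f : Sym2 V), f ∈ G.edgeSet ∧ f ∉ Set.range b ∧
    IsSpanningTreeOf G (Set.range (Function.update b i f)) ∧ b' = Function.update b i f

/-- Two edges of `G` lie in the same 2-connected component: they are equal or some
cycle of `G` contains both of them. -/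
def SameBlock (G : SimpleGraph V) (e f : Sym2 V) : Prop :=
  e = f ∨ ∃ (v : V) (w : G.Walk v v), w.IsCycle ∧ e ∈ w.edges ∧ f ∈ w.edges

namespace TreeReconfiguration

section

open scoped Classical

variable {ι : Type*}

/-- `Reach Valid k b c`: at most `k` single-value updates lead from `b` to `c`, through
functions satisfying `Valid` only. -/
inductive Reach {α β : Type*} [DecidableEq α] (Valid : (α → β) → Prop) :
    ℕ → (α → β) → (α → β) → Prop
  | refl (k : ℕ) (b : α → β) : Valid b → Reach Valid k b b
  | step (k : ℕ) (b c : α → β) (i : α) (e : β) : Reach Valid k b c →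
      Valid (Function.update c i e) → Reach Valid (k + 1) b (Function.update c i e)

section Reach

variable {α β : Type*} [DecidableEq α] {P Q : (α → β) → Prop} {k l : ℕ} {b c d : α → β}

theorem Reach.valid_right (h : Reach P k b c) : P c := by
  cases h <;> assumption

theorem Reach.mono (h : Reach P k b c) (hPQ : ∀ x, P x → Q x) : Reach Q k b c := by
  induction h with
  | refl k b h => exact .refl k b (hPQ _ h)
  | step k b c i e _ h ih => exact .step k b c i e ih (hPQ _ h)

theorem Reach.mono_steps (h : Reach P k b c) (hkl : k ≤ l) : Reach P l b c := by
  induction h generalizing l with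
  | refl k b h => exact .refl l b h
  | step k b c i e _ h ih =>
    obtain ⟨m, rfl⟩ : ∃ m, l = m + 1 := ⟨l - 1, by omega⟩
    exact .step m b c i e (ih (by omega)) h

theorem Reach.trans (h : Reach P k b c) (h' : Reach P l c d) : Reach P (k + l) b d := by
  induction h' with
  | refl l c _ => exact h.mono_steps (by omega)
  | step l c d i e _ hd ih => exact .step (k + l) b d i e (ih h) hd

end Reach

/-- Every vertex of `D` is joined to `S` by edges of `E`. -/
def Good (E : Set (Sym2 V)) (S D : Set V) : Prop :=
  ∀ d ∈ D, ∃ s ∈ S, (SimpleGraph.fromEdgeSet E).Reachable d s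

theorem reachable_of_mem {E : Set (Sym2 V)} {x y : V} (h : s(x, y) ∈ E) :
    (SimpleGraph.fromEdgeSet E).Reachable x y := by
  by_cases hxy : x = y
  · subst hxy; rfl
  · exact SimpleGraph.Adj.reachable (by simp [h, hxy])

theorem reachable_mono {E E' : Set (Sym2 V)} (h : E ⊆ E') {x y : V}
    (hxy : (SimpleGraph.fromEdgeSet E).Reachable x y) :
    (SimpleGraph.fromEdgeSet E').Reachable x y :=
  hxy.mono (SimpleGraph.fromEdgeSet_mono h)

theorem Good.mono {E E' : Set (Sym2 V)} {S D : Set V} (h : Good E S D) (hE : E ⊆ E') :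
    Good E' S D := fun d hd =>
  let ⟨s, hs, hr⟩ := h d hd
  ⟨s, hs, reachable_mono hE hr⟩

theorem Good.trans {E : Set (Sym2 V)} {S P D : Set V} (h : Good E S P)
    (h' : Good E (S ∪ P) D) : Good E S (P ∪ D) := by
  rintro d (hd | hd)
  · exact h d hd
  · obtain ⟨x, hx | hx, hr⟩ := h' d hd
    · exact ⟨x, hx, hr⟩
    · obtain ⟨s, hs, hr'⟩ := h x hx
      exact ⟨s, hs, hr.trans hr'⟩

/-- Following pointers along which a rank decreases leads from `X` to `A`. -/
theorem good_of_rank {E : Set (Sym2 V)} {A X : Set V} (f : V → V) (rk : V → ℕ)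
    (h : ∀ x ∈ X, s(x, f x) ∈ E ∧ (f x ∈ A ∨ f x ∈ X ∧ rk (f x) < rk x)) : Good E A X := by
  intro x hx
  induction hn : rk x using Nat.strong_induction_on generalizing x with
  | _ n ih =>
    obtain ⟨he, ha | ⟨hX, hlt⟩⟩ := h x hx
    · exact ⟨f x, ha, reachable_of_mem he⟩
    · obtain ⟨a, ha, hr⟩ := ih _ (hn ▸ hlt) _ hX rfl
      exact ⟨a, ha, (reachable_of_mem he).trans hr⟩

/-- The configuration `c` uses edges of `H` on the labels `J`, joins `D` to `S` by them, and
agrees with `b` off `J`. -/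
structure LocalValid (H : SimpleGraph V) (S D : Set V) (J : Set ι) (b c : ι → Sym2 V) :
    Prop where
  fixed : ∀ i ∉ J, c i = b i
  edge : ∀ i ∈ J, c i ∈ H.edgeSet
  good : Good (c '' J) S D

theorem LocalValid.lift {H : SimpleGraph V} {S S' D D' : Set V} {J J' : Set ι}
    {b c : ι → Sym2 V} (h : LocalValid H S' D' J' b c) (hJ : J' ⊆ J)
    (hb : ∀ i ∈ J \ J', b i ∈ H.edgeSet)
    (hg : ∀ A, Good A S' D' → Good (A ∪ b '' (J \ J')) S D) : LocalValid H S D J b c where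
  fixed i hi := h.fixed i fun hi' => hi (hJ hi')
  edge i hi := by
    by_cases hi' : i ∈ J'
    · exact h.edge i hi'
    · rw [h.fixed i hi']; exact hb i ⟨hi, hi'⟩
  good := by
    refine (hg _ h.good).mono ?_
    rintro e (⟨i, hi, rfl⟩ | ⟨i, hi, rfl⟩)
    · exact ⟨i, hJ hi, rfl⟩
    · exact ⟨i, hi.1, h.fixed i hi.2⟩

theorem LocalValid.congr_base {H : SimpleGraph V} {S D : Set V} {J : Set ι}
    {b b' c : ι → Sym2 V} (h : LocalValid H S D J b c) (hb : ∀ i ∉ J, b i = b' i) :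
    LocalValid H S D J b' c :=
  ⟨fun i hi => (h.fixed i hi).trans (hb i hi), h.edge, h.good⟩

/-- The configuration in which label `i ∈ J` sits at vertex `p i` and the label at vertex `v`
carries the edge `F v`. -/
noncomputable def cfg (J : Set ι) (b : ι → Sym2 V) (p : ι → V) (F : V → Sym2 V) (i : ι) :
    Sym2 V :=
  if i ∈ J then F (p i) else b i

/-- The edges `F v` for `v ∈ D` belong to `H` and join `D` to `S`. -/
def Admissible (H : SimpleGraph V) (S D : Set V) (F : V → Sym2 V) : Prop :=
  (∀ v ∈ D, F v ∈ H.edgeSet) ∧ Good (F '' D) S D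

section Moves

variable {H : SimpleGraph V} {S D : Set V} {J : Set ι} {b : ι → Sym2 V} {p : ι → V}
  {F F' : V → Sym2 V}

theorem Admissible.localValid (hF : Admissible H S D F) (hp : BijOn p J D) :
    LocalValid H S D J b (cfg J b p F) where
  fixed i hi := by simp [cfg, hi]
  edge i hi := by simpa [cfg, hi] using hF.1 _ (hp.mapsTo hi)
  good := by
    refine hF.2.mono ?_
    rintro e ⟨v, hv, rfl⟩
    obtain ⟨i, hi, rfl⟩ := hp.surjOn hv
    exact ⟨i, hi, by simp [cfg, hi]⟩

theorem cfg_congr (h : ∀ v ∈ D, F v = F' v) (hp : BijOn p J D) :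
    cfg J b p F = cfg J b p F' := by
  funext i
  unfold cfg
  split_ifs with hi
  · exact h _ (hp.mapsTo hi)
  · rfl

theorem reach_edge [DecidableEq ι] (hp : BijOn p J D) (hF : Admissible H S D F)
    (hF' : Admissible H S D F') {v : V} (hv : v ∈ D) (h : ∀ x ∈ D, x ≠ v → F x = F' x) :
    Reach (LocalValid H S D J b) 1 (cfg J b p F) (cfg J b p F') := by
  obtain ⟨i, hi, rfl⟩ := hp.surjOn hv
  have key : cfg J b p F' = Function.update (cfg J b p F) i (F' (p i)) := by
    funext j
    by_cases hj : j = i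
    · subst hj; simp [cfg, hi]
    · rw [Function.update_of_ne hj]
      unfold cfg
      split_ifs with hjJ
      · exact (h _ (hp.mapsTo hjJ) fun h' => hj (hp.injOn hjJ hi h')).symm
      · rfl
  have h1 := hF'.localValid (b := b) hp
  rw [key] at h1 ⊢
  exact .step 0 _ _ _ _ (.refl 0 _ (hF.localValid hp)) h1

theorem bijOn_swap {u v : V} (hu : u ∈ D) (hv : v ∈ D) (hp : BijOn p J D) :
    BijOn (Equiv.swap u v ∘ p) J D := by
  refine BijOn.comp ?_ hp
  refine ⟨fun x hx => ?_, (Equiv.injective _).injOn, fun x hx => ⟨Equiv.swap u v x, ?_, by simp⟩⟩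
  all_goals
    rw [Equiv.swap_apply_def]
    split_ifs <;> assumption

theorem reach_swap [DecidableEq ι] (hp : BijOn p J D) (hF : Admissible H S D F) {u v : V}
    (hu : u ∈ D) (hv : v ∈ D) {e : Sym2 V} (he : e ∈ H.edgeSet)
    (h1 : Good (F '' (D \ {u}) ∪ {e}) S D) (h2 : Good (F '' (D \ {v}) ∪ {e}) S D) :
    Reach (LocalValid H S D J b) 3 (cfg J b p F) (cfg J b (Equiv.swap u v ∘ p) F) := by
  by_cases huv : u = v
  · subst huv
    rw [Equiv.swap_self]
    exact .refl 3 _ (hF.localValid hp)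
  have hvu : v ≠ u := Ne.symm huv
  set F1 := Function.update F u e with hF1
  set F2 := Function.update F1 v (F u) with hF2
  have a1 : Admissible H S D F1 := by
    constructor
    · intro x hx
      by_cases hxu : x = u
      · subst hxu; simpa [hF1] using he
      · simpa [hF1, hxu] using hF.1 x hx
    · refine h1.mono ?_
      rintro _ (⟨x, ⟨hx, hxu⟩, rfl⟩ | rfl)
      · exact ⟨x, hx, by simp only [mem_singleton_iff] at hxu; simp [hF1, hxu]⟩
      · exact ⟨u, hu, by simp [hF1]⟩
  have a2 : Admissible H S D F2 := by
    constructor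
    · intro x hx
      by_cases hxv : x = v
      · subst hxv; simpa [hF2] using hF.1 u hu
      · simpa [hF2, hxv] using a1.1 x hx
    · refine h2.mono ?_
      rintro _ (⟨x, ⟨hx, hxv⟩, rfl⟩ | rfl)
      · simp only [mem_singleton_iff] at hxv
        by_cases hxu : x = u
        · subst hxu; exact ⟨v, hv, by simp [hF2]⟩
        · exact ⟨x, hx, by simp [hF2, hF1, hxv, hxu]⟩
      · exact ⟨u, hu, by simp [hF2, hF1, huv]⟩
  have hswap : ∀ x ∈ D, (F ∘ Equiv.swap u v) x = Function.update F2 u (F v) x := by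
    intro x _
    simp only [Function.comp, Equiv.swap_apply_def, hF2, hF1, Function.update_apply]
    split_ifs <;> simp_all
  have a3 : Admissible H S D (F ∘ Equiv.swap u v) := by
    constructor
    · intro x hx
      refine hF.1 _ ?_
      rw [Equiv.swap_apply_def]
      split_ifs <;> assumption
    · refine hF.2.mono ?_
      rintro _ ⟨x, hx, rfl⟩
      refine ⟨Equiv.swap u v x, ?_, by simp⟩
      rw [Equiv.swap_apply_def]
      split_ifs <;> assumption
  have r1 := reach_edge (b := b) hp hF a1 hu fun x _ hx => by simp [hF1, hx]
  have r2 := reach_edge (b := b) hp a1 a2 hv fun x _ hx => by simp [hF2, hx]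
  have r3 := reach_edge (b := b) hp a2 a3 hu fun x hx' hx => by rw [hswap x hx']; simp [hx]
  have : cfg J b (Equiv.swap u v ∘ p) F = cfg J b p (F ∘ Equiv.swap u v) := by
    funext i; simp [cfg]
  rw [this]
  exact (r1.trans r2).trans r3

end Moves

/-- The edge from a vertex to its parent. -/
def parentEdge (f : V → V) (v : V) : Sym2 V := s(v, f v)

/-- `f` is a parent function on `D` whose pointers lead to `S`. -/
def ParentTree (H : SimpleGraph V) (S D : Set V) (f : V → V) : Prop :=
  ∃ rk : V → ℕ, ∀ d ∈ D, H.Adj d (f d) ∧ (f d ∈ S ∨ f d ∈ D ∧ rk (f d) < rk d)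

section ParentTree

variable {H : SimpleGraph V} {S S' D D₁ D₂ : Set V} {f g : V → V}

theorem ParentTree.adj (h : ParentTree H S D f) {d : V} (hd : d ∈ D) : H.Adj d (f d) :=
  (h.choose_spec d hd).1

theorem ParentTree.mem (h : ParentTree H S D f) {d : V} (hd : d ∈ D) : f d ∈ S ∪ D :=
  (h.choose_spec d hd).2.imp id And.left

theorem ParentTree.good (h : ParentTree H S D f) : Good (parentEdge f '' D) S D := by
  obtain ⟨rk, h⟩ := h
  exact good_of_rank f rk fun x hx => ⟨⟨x, hx, rfl⟩, (h x hx).2⟩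

theorem ParentTree.admissible (h : ParentTree H S D f) :
    Admissible H S D (parentEdge f) :=
  ⟨fun _ hv => h.adj hv, h.good⟩

theorem ParentTree.mono (h : ParentTree H S D f) (hS : S ⊆ S') : ParentTree H S' D f := by
  obtain ⟨rk, h⟩ := h
  exact ⟨rk, fun d hd => ⟨(h d hd).1, (h d hd).2.imp (@hS _) id⟩⟩

theorem ParentTree.congr (h : ParentTree H S D f) (hfg : ∀ d ∈ D, f d = g d) :
    ParentTree H S D g := by
  obtain ⟨rk, h⟩ := h
  exact ⟨rk, fun d hd => hfg d hd ▸ h d hd⟩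

theorem ParentTree.union [Finite V] (h₁ : ParentTree H S D₁ f)
    (h₂ : ParentTree H (S ∪ D₁) D₂ f) : ParentTree H S (D₁ ∪ D₂) f := by
  have := Fintype.ofFinite V
  obtain ⟨r₁, h₁⟩ := h₁
  obtain ⟨r₂, h₂⟩ := h₂
  have hM : ∀ v, r₁ v ≤ ∑ x, r₁ x := fun v =>
    Finset.single_le_sum (f := r₁) (fun _ _ => Nat.zero_le _) (Finset.mem_univ v)
  refine ⟨fun v => if v ∈ D₁ then r₁ v else ∑ x, r₁ x + r₂ v + 1, fun d hd => ?_⟩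
  by_cases hd1 : d ∈ D₁
  · refine ⟨(h₁ d hd1).1, (h₁ d hd1).2.imp id fun ⟨h, h'⟩ => ⟨Or.inl h, by simp [hd1, h, h']⟩⟩
  · have hd2 : d ∈ D₂ := hd.resolve_left hd1
    refine ⟨(h₂ d hd2).1, ?_⟩
    obtain (h | h) | ⟨h, h'⟩ := (h₂ d hd2).2
    · exact Or.inl h
    · refine Or.inr ⟨Or.inl h, ?_⟩
      have := hM (f d)
      simp only [hd1, h, if_true, if_false]
      omega
    · refine Or.inr ⟨Or.inr h, ?_⟩
      have := hM (f d)
      simp only [hd1, if_false]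
      split_ifs <;> omega

end ParentTree

section Switch

variable {H : SimpleGraph V} {S D : Set V} {J : Set ι} {b : ι → Sym2 V} {p : ι → V}
  {f g : V → V}

/-- Vertices of `A` use the parent function `g`, the others use `f`. -/
noncomputable def mixedEdge (f g : V → V) (A : Set V) (v : V) : Sym2 V :=
  if v ∈ A then parentEdge g v else parentEdge f v

theorem ParentTree.admissible_mixedEdge (hf : ParentTree H S D f) (hg : ParentTree H S D g)
    {A : Set V} (hA : A ⊆ D) (hc : ∀ x ∈ A, g x ∈ S ∪ A) :
    Admissible H S D (mixedEdge f g A) := by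
  constructor
  · intro v hv
    unfold mixedEdge
    split_ifs
    · exact hg.adj hv
    · exact hf.adj hv
  · obtain ⟨r, hf⟩ := hf
    obtain ⟨r', hg⟩ := hg
    have h1 : Good (mixedEdge f g A '' D) S A := by
      refine good_of_rank g r' fun x hx => ⟨⟨x, hA hx, by simp [mixedEdge, hx, parentEdge]⟩, ?_⟩
      obtain h | h := (hg x (hA hx)).2
      · exact Or.inl h
      · exact (hc x hx).imp id fun h' => ⟨h', h.2⟩
    have h2 : Good (mixedEdge f g A '' D) (S ∪ A) (D \ A) := by
      refine good_of_rank f r fun x hx =>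
        ⟨⟨x, hx.1, by simp [mixedEdge, hx.2, parentEdge]⟩, ?_⟩
      obtain h | h := (hf x hx.1).2
      · exact Or.inl (Or.inl h)
      · by_cases hxA : f x ∈ A
        · exact Or.inl (Or.inr hxA)
        · exact Or.inr ⟨⟨h.1, hxA⟩, h.2⟩
    simpa [union_sdiff_cancel hA] using h1.trans h2

/-- Parent functions can be exchanged while every label stays at its vertex. -/
theorem ParentTree.reach_switch [Finite V] [DecidableEq ι] (hf : ParentTree H S D f)
    (hg : ParentTree H S D g) (hp : BijOn p J D) :
    Reach (LocalValid H S D J b) D.ncard (cfg J b p (parentEdge f))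
      (cfg J b p (parentEdge g)) := by
  have key : ∀ n : ℕ, ∀ A ⊆ D, (∀ x ∈ A, g x ∈ S ∪ A) → (D \ A).ncard = n →
      Reach (LocalValid H S D J b) n (cfg J b p (mixedEdge f g A))
        (cfg J b p (parentEdge g)) := by
    intro n
    induction n with
    | zero =>
      intro A hA hc hn
      rw [Set.ncard_eq_zero, sdiff_eq_empty] at hn
      rw [cfg_congr (F' := parentEdge g) (D := D) (fun v hv => by simp [mixedEdge, hn hv]) hp]
      exact .refl _ _ (hg.admissible.localValid hp)
    | succ n ih =>
      intro A hA hc hn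
      obtain ⟨r, hr⟩ := id hg
      obtain ⟨v, hv, hmin⟩ := Set.exists_min_image (D \ A) r (Set.toFinite _)
        (Set.nonempty_of_ncard_ne_zero (by omega))
      have hA' : insert v A ⊆ D := insert_subset hv.1 hA
      have hc' : ∀ x ∈ insert v A, g x ∈ S ∪ insert v A := by
        rintro x (rfl | hx)
        · obtain h | ⟨h, hlt⟩ := (hr x hv.1).2
          · exact Or.inl h
          · by_cases hgA : g x ∈ A
            · exact Or.inr (Or.inr hgA)
            · exact absurd (hmin _ ⟨h, hgA⟩) (by omega)
        · exact (hc x hx).imp id Or.inr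
      have hn' : (D \ insert v A).ncard = n := by
        have : D \ insert v A = (D \ A) \ {v} := by ext; simp; tauto
        rw [this, Set.ncard_sdiff_singleton_of_mem hv, hn]; rfl
      have h1 := reach_edge (b := b) hp (hf.admissible_mixedEdge hg hA hc)
        (hf.admissible_mixedEdge hg hA' hc') hv.1
        (fun x _ hx => by simp [mixedEdge, hx])
      exact (h1.trans (ih _ hA' hc' hn')).mono_steps (by omega)
  have := key D.ncard ∅ (empty_subset _) (by simp) (by simp)
  rwa [cfg_congr (F' := parentEdge f) (D := D) (fun v _ => by simp [mixedEdge]) hp] at this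

end Switch

/-- Labels at the vertices of the parent tree `f` can be rearranged within `T` moves as long
as every label moves between vertices related by `E`. -/
def Sortable (ι : Type*) [DecidableEq ι] (H : SimpleGraph V) (S D : Set V) (f : V → V)
    (E : V → V → Prop) (T : ℕ) : Prop :=
  ∀ (J : Set ι) (b : ι → Sym2 V) (p q : ι → V), BijOn p J D → BijOn q J D →
    (∀ i ∈ J, E (p i) (q i)) →
    Reach (LocalValid H S D J b) T (cfg J b p (parentEdge f)) (cfg J b q (parentEdge f))

theorem cfg_congr_left {J : Set ι} {b : ι → Sym2 V} {p q : ι → V} {F : V → Sym2 V}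
    (h : ∀ i ∈ J, p i = q i) : cfg J b p F = cfg J b q F := by
  funext i
  unfold cfg
  split_ifs with hi
  · rw [h i hi]
  · rfl

theorem bijOn_inter_preimage {J : Set ι} {p : ι → V} {D D' : Set V} (hp : BijOn p J D)
    (hD : D' ⊆ D) : BijOn p (J ∩ p ⁻¹' D') D' := by
  refine ⟨fun i hi => hi.2, hp.injOn.mono inter_subset_left, fun v hv => ?_⟩
  obtain ⟨i, hi, rfl⟩ := hp.surjOn (hD hv)
  exact ⟨i, ⟨hi, hv⟩, rfl⟩

section Sortable

variable [DecidableEq ι] {H : SimpleGraph V} {S D D₁ D₂ : Set V} {f g : V → V}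
  {E E' : V → V → Prop} {T T₁ T₂ : ℕ}

theorem Sortable.mono (h : Sortable ι H S D f E T) (hT : T ≤ T₁)
    (hE : ∀ u ∈ D, ∀ v ∈ D, E' u v → E u v) : Sortable ι H S D f E' T₁ :=
  fun J b p q hp hq hpq => (h J b p q hp hq fun i hi =>
    hE _ (hp.mapsTo hi) _ (hq.mapsTo hi) (hpq i hi)).mono_steps hT

theorem Sortable.congr (h : Sortable ι H S D f E T) (hfg : ∀ d ∈ D, f d = g d) :
    Sortable ι H S D g E T := by
  intro J b p q hp hq hpq
  have hF : ∀ v ∈ D, parentEdge g v = parentEdge f v := fun v hv => by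
    simp [parentEdge, hfg v hv]
  rw [cfg_congr hF hp, cfg_congr hF hq]
  exact h J b p q hp hq hpq

theorem Sortable.mono_root (h : Sortable ι H S D f E T) {S' : Set V} (hS : S ⊆ S') :
    Sortable ι H S' D f E T := fun J b p q hp hq hpq =>
  (h J b p q hp hq hpq).mono fun _ hx => ⟨hx.fixed, hx.edge, fun d hd =>
    let ⟨s, hs, hr⟩ := hx.good d hd
    ⟨s, hS hs, hr⟩⟩

theorem sortable_empty : Sortable ι H S ∅ f E 0 := by
  intro J b p q hp hq hpq
  rw [cfg_congr_left (p := p) (q := q) fun i hi => absurd (hp.mapsTo hi) (by simp)]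
  exact .refl _ _ (Admissible.localValid ⟨by simp, by intro d hd; simp at hd⟩ hq)

theorem Sortable.union (h₁ : Sortable ι H S D₁ f E T₁)
    (h₂ : Sortable ι H (S ∪ D₁) D₂ f E T₂) (t₁ : ParentTree H S D₁ f)
    (t₂ : ParentTree H (S ∪ D₁) D₂ f) (hd : Disjoint D₁ D₂)
    (hE : ∀ u ∈ D₁, ∀ v ∈ D₂, ¬ E u v ∧ ¬ E v u) :
    Sortable ι H S (D₁ ∪ D₂) f E (T₁ + T₂) := by
  intro J b p q hp hq hpq
  have hiff : ∀ i ∈ J, (p i ∈ D₁ ↔ q i ∈ D₁) := by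
    intro i hi
    have h := hpq i hi
    constructor
    · intro h1
      exact (hq.mapsTo hi).resolve_right fun h2 => (hE _ h1 _ h2).1 h
    · intro h1
      exact (hp.mapsTo hi).resolve_right fun h2 => (hE _ h1 _ h2).2 h
  set J₁ := J ∩ p ⁻¹' D₁ with hJ₁
  set J₂ := J ∩ p ⁻¹' D₂ with hJ₂
  have hnot : ∀ v, v ∈ D₁ → v ∉ D₂ := fun v h h' => hd.le_bot ⟨h, h'⟩
  have hdiff₁ : J \ J₁ = J₂ := by
    ext i
    simp only [hJ₁, hJ₂, mem_sdiff, mem_inter_iff, mem_preimage]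
    constructor
    · rintro ⟨hi, h⟩
      exact ⟨hi, (hp.mapsTo hi).resolve_left fun h' => h ⟨hi, h'⟩⟩
    · rintro ⟨hi, h⟩
      exact ⟨hi, fun h' => hnot _ h'.2 h⟩
  have hdiff₂ : J \ J₂ = J₁ := by
    rw [← hdiff₁]; simp [hJ₁]
  have hp₁ : BijOn p J₁ D₁ := bijOn_inter_preimage hp subset_union_left
  have hp₂ : BijOn p J₂ D₂ := bijOn_inter_preimage hp subset_union_right
  have hq₁ : BijOn q J₁ D₁ := by
    have : J₁ = J ∩ q ⁻¹' D₁ := by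
      ext i
      simp only [hJ₁, mem_inter_iff, mem_preimage]
      exact and_congr_right fun hi => hiff i hi
    rw [this]; exact bijOn_inter_preimage hq subset_union_left
  have hq₂ : BijOn q J₂ D₂ := by
    have : J₂ = J ∩ q ⁻¹' D₂ := by
      ext i
      simp only [hJ₂, mem_inter_iff, mem_preimage]
      refine and_congr_right fun hi => ?_
      have a := hiff i hi
      have a1 := hp.mapsTo hi
      have a2 := hq.mapsTo hi
      have a3 := hnot (p i)
      have a4 := hnot (q i)
      simp only [mem_union] at a1 a2
      tauto
    rw [this]; exact bijOn_inter_preimage hq subset_union_right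
  set F := parentEdge f
  -- the intermediate configuration, in which only the labels of `J₁` have moved
  set m : ι → V := fun i => if i ∈ J₁ then q i else p i with hm
  have hJ₁J : J₁ ⊆ J := inter_subset_left
  have hJ₂J : J₂ ⊆ J := inter_subset_left
  have hdisj : ∀ i ∈ J₂, i ∉ J₁ := fun i h2 h1 => hnot _ h1.2 h2.2
  have r₁ := h₁ J₁ (cfg J b p F) p q hp₁ hq₁ fun i hi => hpq i (hJ₁J hi)
  have r₂ := h₂ J₂ (cfg J b m F) p q hp₂ hq₂ fun i hi => hpq i (hJ₂J hi)
  have e₁ : cfg J₁ (cfg J b p F) p F = cfg J b p F := by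
    funext i
    by_cases h : i ∈ J₁
    · simp [cfg, h, hJ₁J h]
    · simp [cfg, h]
  have e₂ : cfg J₁ (cfg J b p F) q F = cfg J b m F := by
    funext i
    by_cases h : i ∈ J₁
    · simp [cfg, h, hJ₁J h, hm]
    · simp [cfg, h, hm]
  have e₃ : cfg J₂ (cfg J b m F) p F = cfg J b m F := by
    funext i
    by_cases h : i ∈ J₂
    · simp [cfg, h, hJ₂J h, hm, hdisj i h]
    · simp [cfg, h]
  have e₄ : cfg J₂ (cfg J b m F) q F = cfg J b q F := by
    funext i
    by_cases h : i ∈ J₂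
    · simp [cfg, h, hJ₂J h]
    · by_cases hJ : i ∈ J
      · have : i ∈ J₁ := hdiff₂ ▸ ⟨hJ, h⟩
        simp [cfg, h, hJ, hm, this]
      · simp [cfg, h, hJ]
  rw [e₁, e₂] at r₁
  rw [e₃, e₄] at r₂
  refine Reach.trans (c := cfg J b m F) (r₁.mono fun x hx => ?_) (r₂.mono fun x hx => ?_)
  · refine (hx.lift hJ₁J ?_ ?_).congr_base fun i hi => by simp [cfg, hi]
    · rw [hdiff₁]
      intro i hi
      simpa [cfg, hJ₂J hi, F, parentEdge] using t₂.adj (hp₂.mapsTo hi)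
    · rw [hdiff₁]
      intro A hA
      refine (hA.mono subset_union_left).trans (t₂.good.mono ?_)
      rintro _ ⟨v, hv, rfl⟩
      obtain ⟨i, hi, rfl⟩ := hp₂.surjOn hv
      exact Or.inr ⟨i, hi, by simp [cfg, hJ₂J hi, F]⟩
  · refine (hx.lift hJ₂J ?_ ?_).congr_base fun i hi => by simp [cfg, hi]
    · rw [hdiff₂]
      intro i hi
      simpa [cfg, hJ₁J hi, hm, hi, F, parentEdge] using t₁.adj (hq₁.mapsTo hi)
    · rw [hdiff₂]
      intro A hA
      refine (t₁.good.mono ?_).trans (hA.mono subset_union_left)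
      rintro _ ⟨v, hv, rfl⟩
      obtain ⟨i, hi, rfl⟩ := hq₁.surjOn hv
      exact Or.inr ⟨i, hi, by simp [cfg, hJ₁J hi, F, hm, hi]⟩

/-- If `e` closes a cycle with all edges of the parent tree, labels can be transposed along
this cycle, hence rearranged arbitrarily. -/
theorem sortable_of_closing_edge [Finite ι] [Finite V] (t : ParentTree H S D f) {e : Sym2 V}
    (he : e ∈ H.edgeSet) (h : ∀ u ∈ D, Good (parentEdge f '' (D \ {u}) ∪ {e}) S D) :
    Sortable ι H S D f E (3 * D.ncard) := by
  intro J b p q hp hq _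
  have key : ∀ n : ℕ, ∀ p : ι → V, BijOn p J D → {i ∈ J | p i ≠ q i}.ncard ≤ n →
      Reach (LocalValid H S D J b) (3 * n) (cfg J b p (parentEdge f))
        (cfg J b q (parentEdge f)) := by
    intro n
    induction n with
    | zero =>
      intro p hp hn
      have h0 : {i ∈ J | p i ≠ q i} = ∅ := by
        rw [← Set.ncard_eq_zero (Set.toFinite _)]; omega
      rw [cfg_congr_left (p := p) (q := q) fun i hi => ?_]
      · exact .refl _ _ (t.admissible.localValid hq)
      · by_contra hne
        exact (h0 ▸ (⟨hi, hne⟩ : i ∈ {i ∈ J | p i ≠ q i}) : i ∈ (∅ : Set ι))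
    | succ n ih =>
      intro p hp hn
      by_cases h0 : {i ∈ J | p i ≠ q i} = ∅
      · exact (ih p hp (by rw [h0]; simp)).mono_steps (by omega)
      obtain ⟨i, hi, hne⟩ := Set.nonempty_iff_ne_empty.mpr h0
      have hpi := hp.mapsTo hi
      have hqi := hq.mapsTo hi
      have r := reach_swap (b := b) hp t.admissible hpi hqi he (h _ hpi) (h _ hqi)
      have hp' := bijOn_swap hpi hqi hp
      have hlt : {j ∈ J | (Equiv.swap (p i) (q i) ∘ p) j ≠ q j}.ncard
          < {j ∈ J | p j ≠ q j}.ncard := by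
        refine Set.ncard_lt_ncard ⟨fun j hj => ⟨hj.1, fun heq => hj.2 ?_⟩, fun hsub => ?_⟩
        · by_cases hji : j = i
          · subst hji; exact absurd heq hne
          · have h1 : p j ≠ p i := fun h' => hji (hp.injOn hj.1 hi h')
            have h2 : p j ≠ q i := fun h' => hji (hq.injOn hj.1 hi (heq ▸ h'))
            rw [Function.comp, Equiv.swap_apply_of_ne_of_ne h1 h2, heq]
        · exact (hsub ⟨hi, hne⟩).2 (by simp)
      exact (r.trans (ih _ hp' (by omega))).mono_steps (by omega)
  refine key _ p hp ?_
  rw [← hp.image_eq, hp.injOn.ncard_image]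
  exact Set.ncard_le_ncard (fun i hi => hi.1)

end Sortable

/-- Every proper nonempty part of `K` sends an edge to the rest of `K`. -/
def CutConnected (H : SimpleGraph V) (K : Set V) : Prop :=
  ∀ X ⊆ K, X.Nonempty → X ≠ K → ∃ x ∈ X, ∃ y ∈ K \ X, H.Adj x y

/-- The graph obtained from `H[S ∪ D]` by contracting `S` is 2-connected (or has at most one
edge class), phrased in terms of cuts. -/
structure TwoConnectedOver (H : SimpleGraph V) (S D : Set V) : Prop where
  conn : CutConnected H D
  avoid : ∀ X ⊆ D, X.Nonempty → ∀ v ∈ D \ X, ∃ x ∈ X, ∃ y ∈ D \ X ∪ S, y ≠ v ∧ H.Adj x y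
  root : D.Nonempty → ∃ x ∈ D, ∃ s ∈ S, H.Adj x s

section Ordering

variable [Finite V] {H : SimpleGraph V}

/-- The first vertex of an `s`-`t`-ordering. -/
theorem exists_first_vertex {S D T : Set V} (hD : D.Nonempty)
    (hT : ∀ X ⊆ D, X.Nonempty → ∃ x ∈ X, ∃ y ∈ D \ X ∪ T, H.Adj x y)
    (hS : ∀ X ⊆ D, X.Nonempty → ∃ x ∈ X, ∃ y ∈ D \ X ∪ S, H.Adj x y)
    (hST : ∀ X ⊆ D, X.Nonempty → ∀ v ∈ D \ X, ∃ x ∈ X, ∃ y ∈ D \ X ∪ (S ∪ T),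
      y ≠ v ∧ H.Adj x y) :
    ∃ v ∈ D, (∃ s ∈ S, H.Adj v s) ∧
      ∀ X ⊆ D \ {v}, X.Nonempty → ∃ x ∈ X, ∃ y ∈ (D \ {v}) \ X ∪ T, H.Adj x y := by
  by_contra hcon
  push Not at hcon
  have key : ∀ n : ℕ, ∀ v ∈ D, ∀ X ⊆ D \ {v}, X.Nonempty →
      (∀ x ∈ X, ∀ y ∈ (D \ {v}) \ X ∪ T, ¬ H.Adj x y) → X.ncard = n → False := by
    intro n
    induction n using Nat.strong_induction_on with
    | _ n ih =>
      intro v hv X hX hXne hbad hn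
      have hvX : v ∉ X := fun h => (hX h).2 rfl
      have hXD : X ⊆ D := fun x hx => (hX hx).1
      obtain ⟨w, hw, s, hs, hsv, hadj⟩ := hST X hXD hXne v ⟨hv, hvX⟩
      have hsS : s ∈ S := by
        rcases hs with hs | hs | hs
        · exact absurd hadj (hbad w hw s (Or.inl ⟨⟨hs.1, hsv⟩, hs.2⟩))
        · exact hs
        · exact absurd hadj (hbad w hw s (Or.inr hs))
      obtain ⟨X', hX', hX'ne, hbad'⟩ := hcon w (hXD hw) ⟨s, hsS, hadj⟩
      have hwX' : w ∉ X' := fun h => (hX' h).2 rfl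
      have hX'D : X' ⊆ D := fun x hx => (hX' hx).1
      by_cases hvX' : v ∈ X'
      · obtain ⟨x, hx, y, hy, hxy⟩ := hT (X ∪ X') (union_subset hXD hX'D) hXne.inl
        rcases hx with hx | hx
        · refine hbad x hx y ?_ hxy
          refine hy.imp (fun h => ⟨⟨h.1, ?_⟩, fun h' => h.2 (Or.inl h')⟩) id
          rintro rfl; exact h.2 (Or.inr hvX')
        · refine hbad' x hx y ?_ hxy
          refine hy.imp (fun h => ⟨⟨h.1, ?_⟩, fun h' => h.2 (Or.inr h')⟩) id
          rintro rfl; exact h.2 (Or.inl hw)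
      by_cases hZ : (X ∩ X').Nonempty
      · refine ih (X ∩ X').ncard ?_ w (hXD hw) (X ∩ X') (fun x hx => hX' hx.2) hZ ?_ rfl
        · rw [← hn]
          exact Set.ncard_lt_ncard ⟨inter_subset_left, fun h => hwX' (h hw).2⟩
        · rintro x hx y (hy | hy) hxy
          · have hyX' : y ∈ X' := by
              by_contra h
              exact hbad' x hx.2 y (Or.inl ⟨hy.1, h⟩) hxy
            refine hbad x hx.1 y (Or.inl ⟨⟨hy.1.1, ?_⟩, fun h => hy.2 ⟨h, hyX'⟩⟩) hxy
            rintro rfl; exact hvX' hyX'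
          · exact hbad x hx.1 y (Or.inr hy) hxy
      · obtain ⟨x, hx, y, hy, hxy⟩ := hT X' hX'D hX'ne
        have hyw : y = w := by
          by_contra hyw
          exact hbad' x hx y (hy.imp (fun h => ⟨⟨h.1, hyw⟩, h.2⟩) id) hxy
        subst hyw
        refine hbad y hw x (Or.inl ⟨⟨hX'D hx, ?_⟩, fun h => hZ ⟨x, h, hx⟩⟩) hxy.symm
        rintro rfl; exact hvX' hx
  obtain ⟨v, hv, s, hs, hvs⟩ := hS D subset_rfl hD
  have hsS : s ∈ S := hs.resolve_left fun h => h.2 h.1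
  obtain ⟨X, hX, hXne, hbad⟩ := hcon v hv ⟨s, hsS, hvs⟩
  exact key _ v hv X hX hXne hbad rfl

/-- `s`-`t`-orderings: every vertex of `D` has a neighbour `f v` below it or in `S` and a
neighbour `g v` above it or in `T`. -/
theorem exists_st_ordering {S D T : Set V}
    (hT : ∀ X ⊆ D, X.Nonempty → ∃ x ∈ X, ∃ y ∈ D \ X ∪ T, H.Adj x y)
    (hS : ∀ X ⊆ D, X.Nonempty → ∃ x ∈ X, ∃ y ∈ D \ X ∪ S, H.Adj x y)
    (hST : ∀ X ⊆ D, X.Nonempty → ∀ v ∈ D \ X, ∃ x ∈ X, ∃ y ∈ D \ X ∪ (S ∪ T),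
      y ≠ v ∧ H.Adj x y) :
    ∃ (f g : V → V) (num : V → ℕ), ∀ v ∈ D,
      H.Adj v (f v) ∧ (f v ∈ S ∨ f v ∈ D ∧ num (f v) < num v) ∧
      H.Adj v (g v) ∧ (g v ∈ T ∨ g v ∈ D ∧ num v < num (g v)) := by
  induction hn : D.ncard generalizing S D with
  | zero =>
    rw [Set.ncard_eq_zero] at hn
    subst hn
    exact ⟨id, id, fun _ => 0, by simp⟩
  | succ n ih =>
    obtain ⟨v, hv, ⟨s, hs, hvs⟩, hT'⟩ := exists_first_vertex
      (Set.nonempty_of_ncard_ne_zero (by omega)) hT hS hST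
    have hmem : ∀ {X : Set V} {y : V}, y ∈ D \ X → y ∈ (D \ {v}) \ X ∪ (S ∪ {v}) := by
      intro X y hy
      by_cases hyv : y = v
      · exact Or.inr (Or.inr hyv)
      · exact Or.inl ⟨⟨hy.1, hyv⟩, hy.2⟩
    have hsub : ∀ {X : Set V}, X ⊆ D \ {v} → X ⊆ D := fun hX x hx => (hX hx).1
    obtain ⟨f, g, num, h⟩ := ih (S := S ∪ {v}) (D := D \ {v}) hT'
      (fun X hX hXne => by
        obtain ⟨x, hx, y, hy, hxy⟩ := hS X (hsub hX) hXne
        exact ⟨x, hx, y, hy.elim hmem fun h => Or.inr (Or.inl h), hxy⟩)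
      (fun X hX hXne w hw => by
        obtain ⟨x, hx, y, hy, hyw, hxy⟩ := hST X (hsub hX) hXne w ⟨hw.1.1, hw.2⟩
        refine ⟨x, hx, y, ?_, hyw, hxy⟩
        rcases hy with hy | hy | hy
        · exact (hmem hy).imp id Or.inl
        · exact Or.inr (Or.inl (Or.inl hy))
        · exact Or.inr (Or.inr hy))
      (by rw [Set.ncard_sdiff_singleton_of_mem hv, hn]; rfl)
    obtain ⟨y, hy, hvy⟩ : ∃ y ∈ D \ {v} ∪ T, H.Adj v y := by
      obtain ⟨x, hx, y, hy, hxy⟩ := hT {v} (by simpa using hv) (singleton_nonempty v)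
      rw [mem_singleton_iff] at hx
      exact ⟨y, hy, hx ▸ hxy⟩
    refine ⟨Function.update f v s, Function.update g v y,
      fun x => if x = v then 0 else num x + 1, fun x hx => ?_⟩
    by_cases hxv : x = v
    · subst hxv
      simp only [Function.update_self, if_true]
      refine ⟨hvs, Or.inl hs, hvy, hy.symm.imp id fun h => ⟨h.1, ?_⟩⟩
      rw [if_neg (show ¬ y = x from h.2)]; omega
    · obtain ⟨h1, h2, h3, h4⟩ := h x ⟨hx, hxv⟩
      simp only [Function.update_of_ne hxv, if_neg hxv]
      refine ⟨h1, ?_, h3, h4.imp id fun h => ⟨h.1.1, ?_⟩⟩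
      · obtain (h | h) | h := h2
        · exact Or.inl h
        · rw [mem_singleton_iff] at h
          exact Or.inr ⟨h ▸ hv, by simp [h]⟩
        · refine Or.inr ⟨h.1.1, ?_⟩
          rw [if_neg (show ¬ f x = v from h.1.2)]; omega
      · rw [if_neg (show ¬ g x = v from h.1.2)]; omega

end Ordering

section Hub

variable {H : SimpleGraph V} {S D K : Set V}

theorem CutConnected.insert (hK : CutConnected H K) {x y : V} (hx : x ∈ K)
    (hxy : H.Adj x y) : CutConnected H (insert y K) := by
  intro X hX hXne hne
  by_cases hyX : y ∈ X
  · by_cases hXK : (X ∩ K).Nonempty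
    · by_cases heq : X ∩ K = K
      · exact absurd (hX.antisymm (insert_subset hyX (inter_eq_right.mp heq))) hne
      · obtain ⟨a, ha, c, hc, hac⟩ := hK _ inter_subset_right hXK heq
        exact ⟨a, ha.1, c, ⟨Or.inr hc.1, fun h => hc.2 ⟨h, hc.1⟩⟩, hac⟩
    · exact ⟨y, hyX, x, ⟨Or.inr hx, fun h => hXK ⟨x, h, hx⟩⟩, hxy.symm⟩
  · have hXK : X ⊆ K := fun a ha => (hX ha).resolve_left fun h => hyX (h ▸ ha)
    by_cases heq : X = K
    · exact ⟨x, heq ▸ hx, y, ⟨Or.inl rfl, hyX⟩, hxy⟩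
    · obtain ⟨a, ha, c, hc, hac⟩ := hK X hXK hXne heq
      exact ⟨a, ha, c, ⟨Or.inr hc.1, hc.2⟩, hac⟩

theorem CutConnected.exists_path (hK : CutConnected H K) {a b : V} (ha : a ∈ K) (hb : b ∈ K) :
    ∃ q : List V, q.Nodup ∧ (∀ x ∈ q, x ∈ K) ∧ q.IsChain H.Adj ∧ q.head? = some a ∧
      q.getLast? = some b := by
  by_contra hcon
  set X := {y ∈ K | ∃ q : List V, q.Nodup ∧ (∀ x ∈ q, x ∈ K) ∧ q.IsChain H.Adj ∧
    q.head? = some a ∧ q.getLast? = some y}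
  obtain ⟨x, ⟨-, q, h1, h2, h3, h4, h5⟩, y, ⟨hyK, hyX⟩, hxy⟩ := hK X (fun _ h => h.1)
    ⟨a, ha, [a], by simp, by simpa using ha, by simp, by simp, by simp⟩
    (fun h => hcon ((h.symm ▸ hb : b ∈ X).2))
  refine hyX ⟨hyK, ?_⟩
  by_cases hyq : y ∈ q
  · obtain ⟨q₁, q₂, rfl⟩ := List.append_of_mem hyq
    have hq : q₁ ++ y :: q₂ = (q₁ ++ [y]) ++ q₂ := by simp
    rw [hq] at h1 h2 h3 h4
    refine ⟨q₁ ++ [y], h1.of_append_left, fun x hx => h2 x (List.mem_append_left _ hx),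
      (List.isChain_append.mp h3).1, ?_, by simp⟩
    rwa [List.head?_append_of_ne_nil _ (by simp)] at h4
  · have hq : q ≠ [] := by rintro rfl; simp at h4
    refine ⟨q ++ [y], ?_, ?_, ?_, ?_, by simp⟩
    · refine List.nodup_append.mpr ⟨h1, by simp, fun a ha c hc hac => hyq ?_⟩
      rw [List.mem_singleton] at hc
      rwa [hac, hc] at ha
    · simpa [or_imp, forall_and] using ⟨h2, hyK⟩
    · refine List.isChain_append.mpr ⟨h3, by simp, ?_⟩
      simp [h5, hxy]
    · rwa [List.head?_append_of_ne_nil _ hq]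

theorem exists_last_split {α : Type*} (P : α → Prop) {l : List α} (h : ∃ x ∈ l, P x) :
    ∃ m₁ x m₂, l = m₁ ++ x :: m₂ ∧ P x ∧ ∀ y ∈ m₂, ¬ P y := by
  induction l with
  | nil => simp at h
  | cons a l ih =>
    by_cases hl : ∃ x ∈ l, P x
    · obtain ⟨m₁, x, m₂, rfl, hx, hm⟩ := ih hl
      exact ⟨a :: m₁, x, m₂, rfl, hx, hm⟩
    · push Not at hl
      obtain ⟨x, hx, hP⟩ := h
      obtain rfl | hx := List.mem_cons.mp hx
      · exact ⟨[], x, l, rfl, hP, hl⟩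
      · exact absurd hP (hl x hx)

/-- The vertices of `l` form a path in `D` both of whose ends have neighbours in `S`. -/
def IsEar (H : SimpleGraph V) (S D : Set V) (l : List V) : Prop :=
  l ≠ [] ∧ l.Nodup ∧ (∀ x ∈ l, x ∈ D) ∧
    ∃ s ∈ S, ∃ t ∈ S, (s :: (l ++ [t])).IsChain H.Adj

theorem isEar_of_detour {l₁ q l₃ : List V} {s t : V} (hs : s ∈ S) (ht : t ∈ S)
    (hq : q ≠ []) (hqn : q.Nodup) (hqD : ∀ x ∈ q, x ∈ D) (hqc : q.IsChain H.Adj)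
    (hl : (l₁ ++ l₃).Nodup) (hlD : ∀ x ∈ l₁ ++ l₃, x ∈ D) (hql : ∀ x ∈ q, x ∉ l₁ ++ l₃)
    (h₁ : (s :: l₁).IsChain H.Adj) (h₃ : (l₃ ++ [t]).IsChain H.Adj)
    (h₁q : ∀ x ∈ (s :: l₁).getLast?, ∀ y ∈ q.head?, H.Adj x y)
    (hq₃ : ∀ x ∈ q.getLast?, ∀ y ∈ (l₃ ++ [t]).head?, H.Adj x y) :
    IsEar H S D (l₁ ++ q ++ l₃) := by
  refine ⟨by simp [hq], ?_, ?_, s, hs, t, ht, ?_⟩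
  · have : (q ++ (l₁ ++ l₃)).Nodup :=
      List.nodup_append.mpr ⟨hqn, hl, fun a ha c hc hac => hql a ha (hac ▸ hc)⟩
    refine (List.Perm.nodup_iff ?_).mp this
    rw [← List.append_assoc]
    exact List.perm_append_comm.append_right l₃
  · intro x hx
    simp only [List.mem_append] at hx hlD
    rcases hx with (hx | hx) | hx
    · exact hlD x (Or.inl hx)
    · exact hqD x hx
    · exact hlD x (Or.inr hx)
  · have : s :: (l₁ ++ q ++ l₃ ++ [t]) = (s :: l₁) ++ (q ++ (l₃ ++ [t])) := by simp
    rw [this]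
    refine List.isChain_append.mpr ⟨h₁, List.isChain_append.mpr ⟨hqc, h₃, hq₃⟩, ?_⟩
    rwa [List.head?_append_of_ne_nil _ hq]

/-- If a component `K` of `D` minus an ear has more than half of the vertices of `D`, then the
ear can be rerouted through `K`. -/
theorem IsEar.exists_reroute (hD : TwoConnectedOver H S D) {l : List V} (hl : IsEar H S D l)
    (hKD : K ⊆ D) (hKl : ∀ x ∈ l, x ∉ K) (hKne : K.Nonempty) (hK : CutConnected H K)
    (hatt : ∀ x ∈ K, ∀ y ∈ D \ K, H.Adj x y → y ∈ l) :
    ∃ l', IsEar H S D l' ∧ (∃ x ∈ l', x ∈ K) ∧ ∀ x ∈ K, ∀ y ∈ D \ K, H.Adj x y → y ∈ l' := by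
  obtain ⟨hne, hnd, hlD, s, hs, t, ht, hc⟩ := hl
  have hKneD : K ≠ D := by
    rintro rfl
    obtain ⟨x, hx⟩ := List.exists_mem_of_ne_nil l hne
    exact hKl x hx (hlD x hx)
  obtain ⟨x₀, hx₀, y₀, hy₀, hxy₀⟩ := hD.conn K hKD hKne hKneD
  obtain ⟨m₁, p, m₂, rfl, ⟨a, ha, hap⟩, hm₂⟩ :=
    exists_last_split (fun y => ∃ x ∈ K, H.Adj x y) ⟨y₀, hatt _ hx₀ _ hy₀ hxy₀, x₀, hx₀, hxy₀⟩
  have hm₂' : ∀ y ∈ m₂, ∀ x ∈ K, ¬ H.Adj x y := fun y hy x hx hxy => hm₂ y hy ⟨x, hx, hxy⟩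
  by_cases hKS : ∃ b ∈ K, ∃ t ∈ S, H.Adj b t
  · obtain ⟨b, hb, t', ht', hbt⟩ := hKS
    obtain ⟨q, q1, q2, q3, q4, q5⟩ := hK.exists_path ha hb
    have hqne : q ≠ [] := by rintro rfl; simp at q4
    refine ⟨(m₁ ++ [p]) ++ q ++ [], isEar_of_detour hs ht' hqne q1 (fun x hx => hKD (q2 x hx))
      q3 ?_ ?_ ?_ ?_ (by simp) ?_ ?_, ?_, ?_⟩
    · refine hnd.sublist ?_
      simp
    · intro x hx; exact hlD x (by simp at hx ⊢; tauto)
    · intro x hx hx'; exact hKl x (by simp at hx' ⊢; tauto) (q2 x hx)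
    · have : s :: (m₁ ++ p :: m₂ ++ [t]) = (s :: (m₁ ++ [p])) ++ (m₂ ++ [t]) := by simp
      rw [this] at hc
      exact (List.isChain_append.mp hc).1
    · rw [← List.cons_append, List.getLast?_concat, q4]
      simpa using hap.symm
    · simpa [q5] using hbt
    · exact ⟨a, by simp [List.mem_of_head? q4], ha⟩
    · intro x hx y hy hxy
      have h1 := hatt x hx y hy hxy
      have h2 := fun h => hm₂' y h x hx hxy
      simp at h1 ⊢
      tauto
  · push Not at hKS
    obtain ⟨x₁, hx₁, y₁, hy₁, hy₁p, hxy₁⟩ := hD.avoid K hKD hKne p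
      ⟨hlD p (by simp), hKl p (by simp)⟩
    have hy₁' : y₁ ∈ D \ K := hy₁.resolve_right fun h => hKS _ hx₁ _ h hxy₁
    have hy₁m : y₁ ∈ m₁ := by
      have h1 := hatt _ hx₁ _ hy₁' hxy₁
      have h2 := fun h => hm₂' y₁ h x₁ hx₁ hxy₁
      simp at h1
      tauto
    obtain ⟨n₁, p', n₂, rfl, ⟨a', ha', hap'⟩, hn₂⟩ :=
      exists_last_split (fun y => ∃ x ∈ K, H.Adj x y) ⟨y₁, hy₁m, x₁, hx₁, hxy₁⟩
    have hn₂' : ∀ y ∈ n₂, ∀ x ∈ K, ¬ H.Adj x y := fun y hy x hx hxy => hn₂ y hy ⟨x, hx, hxy⟩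
    obtain ⟨q, q1, q2, q3, q4, q5⟩ := hK.exists_path ha' ha
    have hqne : q ≠ [] := by rintro rfl; simp at q4
    refine ⟨(n₁ ++ [p']) ++ q ++ (p :: m₂), isEar_of_detour hs ht hqne q1
      (fun x hx => hKD (q2 x hx)) q3 ?_ ?_ ?_ ?_ ?_ ?_ ?_, ?_, ?_⟩
    · refine hnd.sublist ?_
      simp
    · intro x hx; exact hlD x (by simp at hx ⊢; tauto)
    · intro x hx hx'; exact hKl x (by simp at hx' ⊢; tauto) (q2 x hx)
    · have : s :: (n₁ ++ p' :: n₂ ++ p :: m₂ ++ [t]) =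
          (s :: (n₁ ++ [p'])) ++ (n₂ ++ p :: m₂ ++ [t]) := by simp
      rw [this] at hc
      exact (List.isChain_append.mp hc).1
    · have : s :: (n₁ ++ p' :: n₂ ++ p :: m₂ ++ [t]) =
          (s :: (n₁ ++ p' :: n₂)) ++ (p :: m₂ ++ [t]) := by simp
      rw [this] at hc
      exact (List.isChain_append.mp hc).2.1
    · rw [← List.cons_append, List.getLast?_concat, q4]
      simpa using hap'.symm
    · simpa [q5] using hap
    · exact ⟨a', by simp [List.mem_of_head? q4], ha'⟩
    · intro x hx y hy hxy
      have h1 := hatt x hx y hy hxy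
      have h2 := fun h => hm₂' y h x hx hxy
      have h3 := fun h => hn₂' y h x hx hxy
      simp at h1 ⊢
      tauto

/-- There is an ear such that every connected set avoiding it has at most half of the
vertices. -/
theorem exists_balanced_ear [Finite V] (hD : TwoConnectedOver H S D) (hne : D.Nonempty) :
    ∃ l, IsEar H S D l ∧
      ∀ K ⊆ D, (∀ x ∈ l, x ∉ K) → CutConnected H K → 2 * K.ncard ≤ D.ncard := by
  have key : ∀ m : ℕ, ∀ l, IsEar H S D l →
      (∀ K ⊆ D, (∀ x ∈ l, x ∉ K) → CutConnected H K → K.ncard ≤ m) →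
      ∃ l, IsEar H S D l ∧
        ∀ K ⊆ D, (∀ x ∈ l, x ∉ K) → CutConnected H K → 2 * K.ncard ≤ D.ncard := by
    intro m
    induction m with
    | zero => exact fun l hl h => ⟨l, hl, fun K h1 h2 h3 => by have := h K h1 h2 h3; omega⟩
    | succ m ih =>
      intro l hl h
      by_cases hm : 2 * (m + 1) ≤ D.ncard
      · exact ⟨l, hl, fun K h1 h2 h3 => by have := h K h1 h2 h3; omega⟩
      by_cases hall : ∀ K ⊆ D, (∀ x ∈ l, x ∉ K) → CutConnected H K → K.ncard ≤ m
      · exact ih l hl hall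
      push Not at hall
      obtain ⟨K, hKD, hKl, hK, hcard⟩ := hall
      have hatt : ∀ x ∈ K, ∀ y ∈ D \ K, H.Adj x y → y ∈ l := by
        intro x hx y hy hxy
        by_contra hyl
        have := h (insert y K) (insert_subset hy.1 hKD)
          (fun z hz hz' => hz'.elim (fun h => hyl (h ▸ hz)) (hKl z hz)) (hK.insert hx hxy)
        rw [Set.ncard_insert_of_notMem hy.2] at this
        omega
      obtain ⟨l', hl', ⟨z, hzl, hzK⟩, hatt'⟩ := hl.exists_reroute hD hKD hKl
        (Set.nonempty_of_ncard_ne_zero (by omega)) hK hatt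
      refine ih l' hl' fun K' hK'D hK'l hK' => ?_
      by_cases hmeet : (K' ∩ K).Nonempty
      · have hsub : K' ⊆ K := by
          by_contra hns
          obtain ⟨x, hx, y, hy, hxy⟩ := hK' (K' ∩ K) inter_subset_left hmeet
            (fun h => hns (inter_eq_left.mp h))
          exact hK'l y (hatt' x hx.2 y ⟨hK'D hy.1, fun h => hy.2 ⟨hy.1, h⟩⟩ hxy) hy.1
        have := Set.ncard_lt_ncard (⟨hsub, fun h => hK'l z hzl (h hzK)⟩ : K' ⊂ K)
        have := h K hKD hKl hK
        omega
      · have hdis : Disjoint K' K := by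
          rw [Set.disjoint_iff_inter_eq_empty, ← Set.not_nonempty_iff_eq_empty]
          exact hmeet
        have h1 := Set.ncard_union_eq hdis
        have h2 := Set.ncard_le_ncard (union_subset hK'D hKD)
        omega
  obtain ⟨x, hx, s, hs, hxs⟩ := hD.root hne
  exact key D.ncard [x] ⟨by simp, by simp, by simpa using hx, s, hs, s, hs,
    by simp [hxs, hxs.symm]⟩ fun K hK _ _ => Set.ncard_le_ncard hK

/-- An ear yields a parent tree together with an edge closing it to a cycle. -/
theorem IsEar.exists_parentTree {l : List V} (hl : IsEar H S D l) :
    ∃ f, ParentTree H S {x | x ∈ l} f ∧ ∃ e ∈ H.edgeSet, ∀ u ∈ l,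
      Good (parentEdge f '' ({x | x ∈ l} \ {u}) ∪ {e}) S {x | x ∈ l} := by
  obtain ⟨hne, hnd, -, s, hs, t, ht, hc⟩ := hl
  set k := l.length with hk
  set w : ℕ → V := fun i => (s :: (l ++ [t])).getD i s with hw
  have hadj : ∀ i ≤ k, H.Adj (w i) (w (i + 1)) := by
    intro i hi
    have := List.isChain_iff_getElem.mp hc i (by simp; omega)
    simpa [hw, List.getD_eq_getElem?_getD, List.getElem?_eq_getElem, hi, ← hk,
      Nat.lt_succ_of_le hi, show i < k + 1 + 1 by omega] using this
  have hw0 : w 0 = s := by simp [hw]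
  have hwk : w (k + 1) = t := by simp [hw, hk]
  have hwl : ∀ v ∈ l, w (l.idxOf v + 1) = v := by
    intro v hv
    have := List.idxOf_lt_length_of_mem hv
    simp [hw, List.getElem?_append_left this, List.getElem?_eq_getElem this]
  have hidx : ∀ i < k, w (i + 1) ∈ l ∧ l.idxOf (w (i + 1)) = i := by
    intro i hi
    have : w (i + 1) = l[i] := by
      simp [hw, List.getElem?_append_left hi, List.getElem?_eq_getElem hi]
    rw [this]
    exact ⟨List.getElem_mem hi, hnd.idxOf_getElem i hi⟩
  have hlt : ∀ v ∈ l, l.idxOf v < k := fun v hv => List.idxOf_lt_length_of_mem hv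
  set f : V → V := fun v => w (l.idxOf v)
  have hf : ∀ v ∈ l, f v ∈ S ∨ f v ∈ l ∧ l.idxOf (f v) < l.idxOf v := by
    intro v hv
    obtain h0 | ⟨i, hi⟩ : l.idxOf v = 0 ∨ ∃ i, l.idxOf v = i + 1 :=
      (Nat.eq_zero_or_eq_succ_pred _).imp id fun h => ⟨_, h⟩
    · left; simpa [f, h0, hw0] using hs
    · have := hidx i (by have := hlt v hv; omega)
      right; simp only [f, hi]; exact ⟨this.1, by omega⟩
  have hfadj : ∀ v ∈ l, H.Adj v (f v) := fun v hv => by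
    have := hadj (l.idxOf v) (hlt v hv).le
    rw [hwl v hv] at this
    exact this.symm
  refine ⟨f, ⟨fun v => l.idxOf v, fun v hv => ⟨hfadj v hv, hf v hv⟩⟩,
    s(w k, w (k + 1)), hadj k le_rfl, fun u hu => ?_⟩
  have g1 : Good (parentEdge f '' ({x | x ∈ l} \ {u}) ∪ {s(w k, w (k + 1))}) S
      {x | x ∈ l ∧ l.idxOf x < l.idxOf u} := by
    refine good_of_rank f (fun v => l.idxOf v) fun x hx => ⟨Or.inl ⟨x, ⟨hx.1, ?_⟩, rfl⟩, ?_⟩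
    · rintro rfl; exact lt_irrefl _ hx.2
    · exact (hf x hx.1).imp id fun h => ⟨⟨h.1, h.2.trans hx.2⟩, h.2⟩
  have g2 : Good (parentEdge f '' ({x | x ∈ l} \ {u}) ∪ {s(w k, w (k + 1))}) S
      {x | x ∈ l ∧ l.idxOf u ≤ l.idxOf x} := by
    refine good_of_rank (fun v => w (l.idxOf v + 2)) (fun v => k - l.idxOf v) fun x hx => ?_
    have hxk := hlt x hx.1
    by_cases hlast : l.idxOf x + 1 = k
    · refine ⟨Or.inr ?_, Or.inl ?_⟩
      · rw [mem_singleton_iff, ← hlast, hwl x hx.1]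
      · rw [show l.idxOf x + 2 = k + 1 by omega, hwk]; exact ht
    · obtain ⟨h1, h2⟩ := hidx (l.idxOf x + 1) (by omega)
      have h3 := hx.2
      refine ⟨Or.inl ⟨w (l.idxOf x + 2), ⟨h1, ?_⟩, ?_⟩, Or.inr ⟨⟨h1, ?_⟩, ?_⟩⟩
      · intro h
        rw [mem_singleton_iff] at h
        rw [h] at h2; omega
      · simp only [parentEdge, f]
        rw [h2, hwl x hx.1, Sym2.eq_swap]
      · rw [h2]; omega
      · show k - l.idxOf (w (l.idxOf x + 1 + 1)) < _
        rw [h2]; omega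
  intro d hd
  by_cases h : l.idxOf d < l.idxOf u
  · exact g1 d ⟨hd, h⟩
  · exact g2 d ⟨hd, not_lt.mp h⟩

end Hub

section Distribution

variable {H : SimpleGraph V} {S P W : Set V} {C : Type*} {c : V → C} {u : C → V}
  {f g : V → V} {num : V → ℕ}

/-- The vertices of `S ∪ P` leading to `S` along parent edges of `P` other than that of `u`. -/
def lowSide (S P : Set V) (f : V → V) (u : V) : Set V :=
  {v | v ∈ S ∪ P ∧ ∃ s ∈ S,
    (SimpleGraph.fromEdgeSet (parentEdge f '' (P \ {u}))).Reachable v s}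

/-- The vertices of `P` leading to `u` along parent edges of `P` other than that of `u`. -/
def highSide (P : Set V) (f : V → V) (u : V) : Set V :=
  {v | v ∈ P ∧ (SimpleGraph.fromEdgeSet (parentEdge f '' (P \ {u}))).Reachable v u}

theorem ParentTree.good_sdiff_singleton (t : ParentTree H S P f) (v : V) :
    Good (parentEdge f '' (P \ {v})) (S ∪ {v}) (P \ {v}) := by
  obtain ⟨rk, h⟩ := t
  refine good_of_rank f rk fun x hx => ⟨⟨x, hx, rfl⟩, ?_⟩
  obtain h' | h' := (h x hx.1).2
  · exact Or.inl (Or.inl h')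
  · by_cases hv : f x = v
    · exact Or.inl (Or.inr hv)
    · exact Or.inr ⟨⟨h'.1, hv⟩, h'.2⟩

theorem ParentTree.subset_lowSide_union_highSide (t : ParentTree H S P f) (v : V) :
    S ∪ P ⊆ lowSide S P f v ∪ highSide P f v := by
  rintro x (hx | hx)
  · exact Or.inl ⟨Or.inl hx, x, hx, SimpleGraph.Reachable.refl x⟩
  · by_cases hxv : x = v
    · exact Or.inr ⟨hx, hxv ▸ SimpleGraph.Reachable.refl x⟩
    · obtain ⟨s, hs | hs, hr⟩ := t.good_sdiff_singleton v x ⟨hx, hxv⟩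
      · exact Or.inl ⟨Or.inr hx, s, hs, hr⟩
      · exact Or.inr ⟨hx, mem_singleton_iff.mp hs ▸ hr⟩

/-- A hub `P` that is a path closed by a further edge, and `W` partitioned into bins, the fibres
of `c`. Each bin is ordered by `num`; `f` leads downwards in the bin and eventually to the low
side of the hub, `g` leads upwards and eventually to the high side, with respect to a vertex
`u k` of the hub chosen for the bin `k`. -/
structure HubSystem (H : SimpleGraph V) (S P W : Set V) {C : Type*} (c : V → C) (u : C → V)
    (f g : V → V) (num : V → ℕ) : Prop where
  disj : Disjoint P W
  agree : ∀ v ∈ P, g v = f v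
  tree : ParentTree H S P f
  closing : ∃ e ∈ H.edgeSet, ∀ w ∈ P, Good (parentEdge f '' (P \ {w}) ∪ {e}) S P
  hub : ∀ k, u k ∈ P
  down : ∀ v ∈ W, H.Adj v (f v) ∧ (f v ∈ lowSide S P f (u (c v)) ∨
    f v ∈ W ∧ c (f v) = c v ∧ num (f v) < num v)
  up : ∀ v ∈ W, H.Adj v (g v) ∧ (g v ∈ highSide P f (u (c v)) ∨
    g v ∈ W ∧ c (g v) = c v ∧ num v < num (g v))

/-- In each bin, `A` consists of the first few vertices. -/
def InitialIn (W : Set V) (c : V → C) (num : V → ℕ) (A : Set V) : Prop :=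
  ∀ x ∈ A, ∀ y ∈ W, c y = c x → num y < num x → y ∈ A

/-- The first vertex `v` of a bin outside `A` can be added to `A`. -/
theorem InitialIn.insert {A : Set V} {v : V} (hA : InitialIn W c num A)
    (hmin : ∀ x ∈ W \ A, c x = c v → num v ≤ num x) : InitialIn W c num (insert v A) := by
  rintro x (rfl | hx) y hy hc hlt
  · by_contra h
    have := hmin y ⟨hy, fun h' => h (Or.inr h')⟩ hc
    omega
  · exact Or.inr (hA x hx y hy hc hlt)

theorem exists_leaving [Finite V] {J : Set ι} {p q : ι → V} {D K : Set V} (hp : BijOn p J D)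
    (hq : BijOn q J D) (hK : K ⊆ D) {j : ι} (hj : j ∈ J) (hpj : p j ∉ K) (hqj : q j ∈ K) :
    ∃ i ∈ J, p i ∈ K ∧ q i ∉ K := by
  by_contra hcon
  push Not at hcon
  have hb := bijOn_inter_preimage hp hK
  have hsub : q '' (insert j (J ∩ p ⁻¹' K)) ⊆ K := by
    rintro _ ⟨i, rfl | hi, rfl⟩
    · exact hqj
    · exact hcon i hi.1 hi.2
  have hinj : InjOn q (insert j (J ∩ p ⁻¹' K)) :=
    hq.injOn.mono (insert_subset hj inter_subset_left)
  have h1 := Set.ncard_le_ncard hsub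
  have hfin : (J ∩ p ⁻¹' K).Finite := Set.Finite.of_finite_image
    (by rw [hb.image_eq]; exact Set.toFinite K) hb.injOn
  rw [hinj.ncard_image, Set.ncard_insert_of_notMem (fun h => hpj h.2) hfin,
    ← hb.injOn.ncard_image, hb.image_eq] at h1
  omega

namespace HubSystem

variable {A : Set V} {v w : V}

theorem downTree (hs : HubSystem H S P W c u f g num) : ParentTree H (S ∪ P) W f :=
  ⟨num, fun v hv => ⟨(hs.down v hv).1, (hs.down v hv).2.imp (fun h => h.1)
    fun h => ⟨h.1, h.2.2⟩⟩⟩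

theorem upTree (hs : HubSystem H S P W c u f g num) [Finite V] : ParentTree H (S ∪ P) W g := by
  have := Fintype.ofFinite V
  have hM : ∀ v, num v ≤ ∑ x, num x := fun v =>
    Finset.single_le_sum (f := num) (fun _ _ => Nat.zero_le _) (Finset.mem_univ v)
  refine ⟨fun v => ∑ x, num x - num v, fun v hv => ⟨(hs.up v hv).1, (hs.up v hv).2.imp
    (fun h => Or.inr h.1) fun h => ⟨h.1, ?_⟩⟩⟩
  have := hM (g v)
  have := h.2.2
  show ∑ x, num x - num (g v) < ∑ x, num x - num v
  omega

theorem canonicalTree (hs : HubSystem H S P W c u f g num)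
    [Finite V] {fc : V → V} (ht : ParentTree H (S ∪ P) W fc)
    (hfc : ∀ v ∈ P, fc v = f v) : ParentTree H S (P ∪ W) fc :=
  (hs.tree.congr fun v hv => (hfc v hv).symm).union ht

theorem mixedEdge_hub (hs : HubSystem H S P W c u f g num)
    (hv : v ∈ P) : mixedEdge g f A v = parentEdge f v := by
  unfold mixedEdge
  split_ifs
  · rfl
  · simp [parentEdge, hs.agree v hv]

theorem mem_initialIn_of_down (hs : HubSystem H S P W c u f g num)
    (hA : InitialIn W c num A) (hv : v ∈ A) (hvW : v ∈ W) :
    f v ∈ lowSide S P f (u (c v)) ∨ f v ∈ A ∧ c (f v) = c v ∧ num (f v) < num v :=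
  (hs.down v hvW).2.imp id fun h => ⟨hA v hv _ h.1 h.2.1 h.2.2, h.2⟩

theorem good_bins (hs : HubSystem H S P W c u f g num)
    [Finite V] (hAW : A ⊆ W) (hA : InitialIn W c num A) :
    Good (mixedEdge g f A '' W) (S ∪ P) W := by
  refine (hs.upTree.admissible_mixedEdge hs.downTree hAW fun x hx => ?_).2
  exact (hs.mem_initialIn_of_down hA hx (hAW hx)).imp (fun h => h.1) fun h => h.1

theorem image_hub (hs : HubSystem H S P W c u f g num) (v : V) :
    parentEdge f '' (P \ {v}) ⊆ mixedEdge g f A '' ((P ∪ W) \ {v}) := by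
  rintro _ ⟨x, hx, rfl⟩
  exact ⟨x, ⟨Or.inl hx.1, hx.2⟩, hs.mixedEdge_hub hx.1⟩

theorem image_bins (hs : HubSystem H S P W c u f g num) (hv : v ∈ P) :
    mixedEdge g f A '' W ⊆ mixedEdge g f A '' ((P ∪ W) \ {v}) := by
  rintro _ ⟨x, hx, rfl⟩
  exact ⟨x, ⟨Or.inr hx, fun h => hs.disj.le_bot ⟨mem_singleton_iff.mp h ▸ hv, hx⟩⟩, rfl⟩

theorem admissible (hs : HubSystem H S P W c u f g num)
    [Finite V] (hAW : A ⊆ W) (hA : InitialIn W c num A) :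
    Admissible H S (P ∪ W) (mixedEdge g f A) := by
  constructor
  · rintro x (hx | hx)
    · rw [hs.mixedEdge_hub hx]; exact hs.tree.adj hx
    · unfold mixedEdge
      split_ifs
      · exact (hs.down x hx).1
      · exact (hs.up x hx).1
  · refine (hs.tree.good.mono ?_).trans ((hs.good_bins hAW hA).mono ?_)
    · rintro _ ⟨x, hx, rfl⟩
      exact ⟨x, Or.inl hx, hs.mixedEdge_hub hx⟩
    · exact image_mono subset_union_right

theorem good_without_hub (hs : HubSystem H S P W c u f g num)
    [Finite V] (hAW : A ⊆ W) (hA : InitialIn W c num A) (hv : v ∈ W \ A)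
    (hmin : ∀ x ∈ W \ A, c x = c v → num v ≤ num x) :
    Good (mixedEdge g f A '' ((P ∪ W) \ {u (c v)}) ∪ {parentEdge f v}) S (P ∪ W) := by
  have := Fintype.ofFinite V
  set E := mixedEdge g f A '' ((P ∪ W) \ {u (c v)}) ∪ {parentEdge f v}
  have huP := hs.hub (c v)
  have hE₁ : parentEdge f '' (P \ {u (c v)}) ⊆ E :=
    (hs.image_hub _).trans subset_union_left
  have hE₂ : mixedEdge g f A '' W ⊆ E := (hs.image_bins huP).trans subset_union_left
  have down : Good E (lowSide S P f (u (c v))) {x | x ∈ insert v A ∧ c x = c v} := by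
    refine good_of_rank f num ?_
    rintro x ⟨rfl | hx, hc⟩
    · exact ⟨Or.inr rfl, (hs.mem_initialIn_of_down (hA.insert hmin)
        (Or.inl rfl) hv.1).imp id fun h => ⟨⟨h.1, h.2.1⟩, h.2.2⟩⟩
    · refine ⟨hE₂ ⟨x, hAW hx, by simp [mixedEdge, hx, parentEdge]⟩, ?_⟩
      rw [← hc]
      exact (hs.mem_initialIn_of_down hA hx (hAW hx)).imp id
        fun h => ⟨⟨Or.inr h.1, h.2.1⟩, h.2.2⟩
  have hM : ∀ v, num v ≤ ∑ x, num x := fun v =>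
    Finset.single_le_sum (f := num) (fun _ _ => Nat.zero_le _) (Finset.mem_univ v)
  have up : Good E (highSide P f (u (c v))) {x | x ∈ W \ A ∧ c x = c v} := by
    refine good_of_rank g (fun x => ∑ y, num y - num x) ?_
    rintro x ⟨hx, hc⟩
    refine ⟨hE₂ ⟨x, hx.1, by simp [mixedEdge, hx.2, parentEdge]⟩, ?_⟩
    rw [← hc]
    refine (hs.up x hx.1).2.imp id fun h =>
      ⟨⟨⟨h.1, fun h' => hx.2 (hA _ h' x hx.1 h.2.1.symm h.2.2)⟩, h.2.1⟩, ?_⟩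
    have := hM (g x)
    have := h.2.2
    show ∑ y, num y - num (g x) < ∑ y, num y - num x
    omega
  obtain ⟨a, ⟨-, s, hsS, has⟩, hva⟩ := down v ⟨Or.inl rfl, rfl⟩
  obtain ⟨b, ⟨-, hbu⟩, hvb⟩ := up v ⟨hv, rfl⟩
  have hus : (SimpleGraph.fromEdgeSet E).Reachable (u (c v)) s :=
    ((reachable_mono hE₁ hbu).symm.trans hvb.symm).trans (hva.trans (reachable_mono hE₁ has))
  refine Good.trans (fun x hx => ?_) ((hs.good_bins hAW hA).mono hE₂)
  obtain ⟨-, s', hs', hr⟩ | ⟨-, hr⟩ :=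
    hs.tree.subset_lowSide_union_highSide (u (c v)) (Or.inr hx)
  · exact ⟨s', hs', reachable_mono hE₁ hr⟩
  · exact ⟨s, hsS, (reachable_mono hE₁ hr).trans hus⟩

section Moves

variable [Finite V] [DecidableEq ι] {J : Set ι} {b : ι → Sym2 V} {p q : ι → V}

theorem reach_flip (hs : HubSystem H S P W c u f g num)
    (hp : BijOn p J (P ∪ W)) (hAW : A ⊆ W) (hA : InitialIn W c num A)
    (hv : v ∈ W \ A) (hmin : ∀ x ∈ W \ A, c x = c v → num v ≤ num x) :
    Reach (LocalValid H S (P ∪ W) J b) 1 (cfg J b p (mixedEdge g f A))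
      (cfg J b p (mixedEdge g f (insert v A))) :=
  reach_edge hp (hs.admissible hAW hA)
    (hs.admissible (insert_subset hv.1 hAW) (hA.insert hmin)) (Or.inr hv.1)
    fun x _ hx => by simp [mixedEdge, hx]

theorem reach_swap_hub (hs : HubSystem H S P W c u f g num)
    (hp : BijOn p J (P ∪ W)) (hAW : A ⊆ W) (hA : InitialIn W c num A)
    (hv : v ∈ P) (hw : w ∈ P) :
    Reach (LocalValid H S (P ∪ W) J b) 3 (cfg J b p (mixedEdge g f A))
      (cfg J b (Equiv.swap v w ∘ p) (mixedEdge g f A)) := by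
  obtain ⟨e, he, hg⟩ := hs.closing
  have key : ∀ x ∈ P, Good (mixedEdge g f A '' ((P ∪ W) \ {x}) ∪ {e}) S (P ∪ W) :=
    fun x hx => ((hg x hx).mono (union_subset_union_left _ (hs.image_hub x))).trans
      ((hs.good_bins hAW hA).mono ((hs.image_bins hx).trans subset_union_left))
  exact reach_swap hp (hs.admissible hAW hA) (Or.inl hv) (Or.inl hw) he (key v hv) (key w hw)

theorem reach_swap_bin (hs : HubSystem H S P W c u f g num)
    (hp : BijOn p J (P ∪ W)) (hAW : A ⊆ W) (hA : InitialIn W c num A)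
    (hv : v ∈ W \ A) (hmin : ∀ x ∈ W \ A, c x = c v → num v ≤ num x) :
    Reach (LocalValid H S (P ∪ W) J b) 3 (cfg J b p (mixedEdge g f A))
      (cfg J b (Equiv.swap (u (c v)) v ∘ p) (mixedEdge g f A)) := by
  refine reach_swap hp (hs.admissible hAW hA) (Or.inl (hs.hub _)) (Or.inr hv.1)
    (e := parentEdge f v) (hs.down v hv.1).1 (hs.good_without_hub hAW hA hv hmin) ?_
  refine (hs.admissible (insert_subset hv.1 hAW) (hA.insert hmin)).2.mono ?_
  rintro _ ⟨x, hx, rfl⟩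
  by_cases hxv : x = v
  · right; simp [hxv, mixedEdge]
  · left; exact ⟨x, ⟨hx, hxv⟩, by simp [mixedEdge, hxv]⟩

theorem reach_swap_hub_bin (hs : HubSystem H S P W c u f g num)
    (hp : BijOn p J (P ∪ W)) (hAW : A ⊆ W) (hA : InitialIn W c num A)
    (hv : v ∈ W \ A) (hmin : ∀ x ∈ W \ A, c x = c v → num v ≤ num x) (hw : w ∈ P) :
    Reach (LocalValid H S (P ∪ W) J b) 9 (cfg J b p (mixedEdge g f A))
      (cfg J b (Equiv.swap w v ∘ p) (mixedEdge g f A)) := by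
  have hu := hs.hub (c v)
  have h1 : BijOn (Equiv.swap (u (c v)) w ∘ p) J (P ∪ W) :=
    bijOn_swap (Or.inl hu) (Or.inl hw) hp
  have h2 : BijOn (Equiv.swap (u (c v)) v ∘ (Equiv.swap (u (c v)) w ∘ p)) J (P ∪ W) :=
    bijOn_swap (Or.inl hu) (Or.inr hv.1) h1
  have key : Equiv.swap w v ∘ p = Equiv.swap (u (c v)) w ∘
      (Equiv.swap (u (c v)) v ∘ (Equiv.swap (u (c v)) w ∘ p)) := by
    funext i
    have hvu : v ≠ u (c v) := fun h => hs.disj.le_bot ⟨h ▸ hu, hv.1⟩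
    have hvw : v ≠ w := fun h => hs.disj.le_bot ⟨h ▸ hw, hv.1⟩
    simp only [Function.comp, Equiv.swap_apply_def]
    split_ifs <;> simp_all
  rw [key]
  exact ((hs.reach_swap_hub hp hAW hA hu hw).trans
    (hs.reach_swap_bin h1 hAW hA hv hmin)).trans (hs.reach_swap_hub h2 hAW hA hu hw)

theorem exists_distribution (hs : HubSystem H S P W c u f g num)
    (hAW : A ⊆ W) (hA : InitialIn W c num A)
    (hp : BijOn p J (P ∪ W)) (hq : BijOn q J (P ∪ W))
    (hinv : ∀ i ∈ J, p i ∈ A → q i ∈ W ∧ c (q i) = c (p i)) :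
    ∃ p', BijOn p' J (P ∪ W) ∧ (∀ i ∈ J, p' i ∈ W → q i ∈ W ∧ c (q i) = c (p' i)) ∧
      Reach (LocalValid H S (P ∪ W) J b) (19 * (W \ A).ncard) (cfg J b p (mixedEdge g f A))
        (cfg J b p' (mixedEdge g f W)) := by
  induction hn : (W \ A).ncard generalizing A p with
  | zero =>
    rw [Set.ncard_eq_zero, sdiff_eq_empty] at hn
    obtain rfl := hAW.antisymm hn
    exact ⟨p, hp, hinv, .refl _ _ ((hs.admissible hAW hA).localValid hp)⟩
  | succ n ih =>
    have hdisj : ∀ {x}, x ∈ P → x ∉ W := fun hP hW => hs.disj.le_bot ⟨hP, hW⟩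
    -- a label of the hub bound for a bin is moved to the first free place of the bin
    have main : ∀ p, BijOn p J (P ∪ W) → (∀ i ∈ J, p i ∈ A → q i ∈ W ∧ c (q i) = c (p i)) →
        (∃ j ∈ J, p j ∈ P ∧ q j ∈ W) →
        ∃ p', BijOn p' J (P ∪ W) ∧ (∀ i ∈ J, p' i ∈ W → q i ∈ W ∧ c (q i) = c (p' i)) ∧
          Reach (LocalValid H S (P ∪ W) J b) (10 + 19 * n) (cfg J b p (mixedEdge g f A))
            (cfg J b p' (mixedEdge g f W)) := by
      rintro p hp hinv ⟨j, hj, hpj, hqj⟩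
      obtain ⟨i, hi, hpi, hqi⟩ := exists_leaving hp hq (K := {x ∈ W | c x = c (q j)})
        (fun x hx => Or.inr hx.1) hj (fun h => hdisj hpj h.1) ⟨hqj, rfl⟩
      have hpiA : p i ∉ A := fun h =>
        hqi ⟨(hinv i hi h).1, (hinv i hi h).2.trans hpi.2⟩
      obtain ⟨v, hv, hmin⟩ := Set.exists_min_image {x ∈ W \ A | c x = c (q j)} num
        (Set.toFinite _) ⟨p i, ⟨hpi.1, hpiA⟩, hpi.2⟩
      have hmin' : ∀ x ∈ W \ A, c x = c v → num v ≤ num x := fun x hx hc =>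
        hmin x ⟨hx, hc.trans hv.2⟩
      have hp' : BijOn (Equiv.swap (p j) v ∘ p) J (P ∪ W) :=
        bijOn_swap (Or.inl hpj) (Or.inr hv.1.1) hp
      have hA' := hA.insert hmin'
      have hAW' : insert v A ⊆ W := insert_subset hv.1.1 hAW
      have r₁ := hs.reach_swap_hub_bin (b := b) hp hAW hA hv.1 hmin' hpj
      have r₂ := hs.reach_flip (b := b) hp' hAW hA hv.1 hmin'
      obtain ⟨p', h1, h2, h3⟩ := ih hAW' hA' hp' (fun i hi hiA => by
        by_cases hij : i = j
        · subst hij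
          simp [hqj, hv.2]
        · have hne : p i ≠ p j := fun h => hij (hp.injOn hi hj h)
          by_cases hiv : p i = v
          · exfalso
            simp only [Function.comp, hiv, Equiv.swap_apply_right] at hiA
            exact hdisj hpj (hAW' hiA)
          · have he : (Equiv.swap (p j) v ∘ p) i = p i :=
              Equiv.swap_apply_of_ne_of_ne hne hiv
            rw [he] at hiA ⊢
            exact hinv i hi (hiA.resolve_left hiv))
        (by
          have : W \ insert v A = (W \ A) \ {v} := by ext; simp; tauto
          rw [this, Set.ncard_sdiff_singleton_of_mem hv.1, hn]; rfl)
      exact ⟨p', h1, h2, (r₁.trans r₂).trans h3⟩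
    by_cases hex : ∃ j ∈ J, p j ∈ P ∧ q j ∈ W
    · obtain ⟨p', h1, h2, h3⟩ := main p hp hinv hex
      exact ⟨p', h1, h2, h3.mono_steps (by omega)⟩
    push Not at hex
    obtain ⟨x, hx⟩ := Set.nonempty_of_ncard_ne_zero (s := W \ A) (by omega)
    obtain ⟨v, hv, hmin⟩ := Set.exists_min_image {y ∈ W \ A | c y = c x} num
      (Set.toFinite _) ⟨x, hx, rfl⟩
    have hmin' : ∀ y ∈ W \ A, c y = c v → num v ≤ num y := fun y hy hc =>
      hmin y ⟨hy, hc.trans hv.2⟩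
    obtain ⟨i, hi, hpi⟩ := hp.surjOn (Or.inr hv.1.1)
    have hqi : q i ∈ W := by
      refine (hq.mapsTo hi).resolve_left fun h => ?_
      obtain ⟨k, hk, hpk, hqk⟩ := exists_leaving hp hq subset_union_left hi
        (fun h' => hdisj (hpi ▸ h') hv.1.1) h
      exact hex k hk hpk ((hq.mapsTo hk).resolve_left hqk)
    have hw := hs.hub (c v)
    have r := hs.reach_swap_hub_bin (b := b) hp hAW hA hv.1 hmin' hw
    obtain ⟨p', h1, h2, h3⟩ := main _ (bijOn_swap (Or.inl hw) (Or.inr hv.1.1) hp)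
      (fun k hk hkA => by
        by_cases hkv : p k = v
        · exfalso
          simp only [Function.comp, hkv, Equiv.swap_apply_right] at hkA
          exact hdisj hw (hAW hkA)
        · by_cases hkw : p k = u (c v)
          · exfalso
            simp only [Function.comp, hkw, Equiv.swap_apply_left] at hkA
            exact hv.1.2 hkA
          · have he : (Equiv.swap (u (c v)) v ∘ p) k = p k :=
              Equiv.swap_apply_of_ne_of_ne hkw hkv
            rw [he] at hkA ⊢
            exact hinv k hk hkA)
      ⟨i, hi, by simpa [hpi] using hw, hqi⟩
    exact ⟨p', h1, h2, (r.trans h3).mono_steps (by omega)⟩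

theorem sortable (hs : HubSystem H S P W c u f g num)
    [Finite ι] {fc : V → V} {T : ℕ} {E : V → V → Prop}
    (ht : ParentTree H (S ∪ P) W fc) (hfc : ∀ v ∈ P, fc v = f v)
    (h : Sortable ι H (S ∪ P) W fc (fun x y => c x = c y) T) :
    Sortable ι H S (P ∪ W) fc E (21 * (P ∪ W).ncard + T) := by
  intro J b p q hp hq _
  have hdisj : ∀ {x}, x ∈ P → x ∉ W := fun h h' => hs.disj.le_bot ⟨h, h'⟩
  have tg : ParentTree H S (P ∪ W) g :=
    (hs.tree.congr fun v hv => (hs.agree v hv).symm).union hs.upTree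
  have tf : ParentTree H S (P ∪ W) f := hs.tree.union hs.downTree
  have tc := hs.canonicalTree ht hfc
  obtain ⟨p', hp', hinv, r₂⟩ := hs.exists_distribution (b := b) (empty_subset W)
    (fun x hx => absurd hx (notMem_empty x)) hp hq fun i _ hi => absurd hi (notMem_empty _)
  have r₁ := tc.reach_switch (b := b) tg hp
  have r₃ := tf.reach_switch (b := b) tc hp'
  rw [cfg_congr (F' := parentEdge g) (fun v _ => by simp [mixedEdge]) hp,
    cfg_congr (F' := parentEdge f) ?_ hp', sdiff_empty] at r₂
  swap
  · rintro v (hv | hv)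
    · exact hs.mixedEdge_hub hv
    · simp [mixedEdge, hv]
  obtain ⟨e, he, hcl⟩ := hs.closing
  have tP : ParentTree H S P fc := hs.tree.congr fun v hv => (hfc v hv).symm
  have sP : Sortable ι H S P fc
      (fun x y => x ∈ P ∧ y ∈ P ∨ x ∈ W ∧ y ∈ W ∧ c x = c y) (3 * P.ncard) := by
    refine (sortable_of_closing_edge (E := fun _ _ => True) hs.tree he hcl).congr
      (fun v hv => (hfc v hv).symm) |>.mono le_rfl fun _ _ _ _ _ => trivial
  have sW := h.mono (E' := fun x y => x ∈ P ∧ y ∈ P ∨ x ∈ W ∧ y ∈ W ∧ c x = c y) le_rfl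
    fun x hx y hy hxy => (hxy.resolve_left fun h' => hdisj h'.1 hx).2.2
  have r₄ := sP.union sW tP ht hs.disj (fun x hx y hy => by
    have := hdisj hx
    have : y ∉ P := fun h => hdisj h hy
    tauto) J b p' q hp' hq (fun i hi => by
      rcases hp'.mapsTo hi with hpi | hpi
      · refine Or.inl ⟨hpi, (hq.mapsTo hi).resolve_right fun hqi => ?_⟩
        obtain ⟨k, hk, hpk, hqk⟩ := exists_leaving hp' hq subset_union_right hi
          (hdisj hpi) hqi
        exact hqk (hinv k hk hpk).1
      · exact Or.inr ⟨hpi, (hinv i hi hpi).1, (hinv i hi hpi).2.symm⟩)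
  refine (((r₁.trans r₂).trans r₃).trans r₄).mono_steps ?_
  have := Set.ncard_union_eq hs.disj
  omega

end Moves

end HubSystem

end Distribution

section Bins

variable {H : SimpleGraph V} {S P W D K : Set V} {C : Type*} {c : V → C}
  {f : V → V}

theorem bins_sortable [Finite V] [DecidableEq ι] {a : ℕ}
    (h : ∀ k ∈ c '' W, ParentTree H S {x ∈ W | c x = k} f ∧
      Sortable ι H S {x ∈ W | c x = k} f (fun _ _ => True) (a * {x ∈ W | c x = k}.ncard)) :
    ParentTree H S W f ∧ Sortable ι H S W f (fun x y => c x = c y) (a * W.ncard) := by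
  induction hn : W.ncard using Nat.strong_induction_on generalizing W with
  | _ n ih =>
    obtain rfl | ⟨w, hw⟩ := W.eq_empty_or_nonempty
    · exact ⟨⟨fun _ => 0, by simp⟩, (sortable_empty (E := fun _ _ => True)).mono (by simp) (by simp)⟩
    set K := {x ∈ W | c x = c w} with hK
    set R := {x ∈ W | c x ≠ c w} with hR
    have hWu : K ∪ R = W := by ext x; simp only [hK, hR, mem_union, mem_ofPred_eq]; tauto
    have hdis : Disjoint K R := Set.disjoint_left.mpr fun x hx hx' => hx'.2 hx.2
    have hcard : K.ncard + R.ncard = n := by rw [← Set.ncard_union_eq hdis, hWu, hn]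
    have hKpos : 0 < K.ncard := (Set.ncard_pos (Set.toFinite _)).mpr ⟨w, hw, rfl⟩
    have hfib : ∀ k ∈ c '' R, {x ∈ R | c x = k} = {x ∈ W | c x = k} := by
      rintro _ ⟨y, hy, rfl⟩
      ext x
      constructor
      · exact fun hx => ⟨hx.1.1, hx.2⟩
      · exact fun hx => ⟨⟨hx.1, fun h' => hy.2 (hx.2.symm.trans h')⟩, hx.2⟩
    obtain ⟨t₂, s₂⟩ := ih R.ncard (by omega) (fun k hk => by
      rw [hfib k hk]
      exact h k (image_mono (fun x hx => hx.1) hk)) rfl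
    obtain ⟨t₁, s₁⟩ := h (c w) ⟨w, hw, rfl⟩
    have t₂' := t₂.mono (subset_union_left : S ⊆ S ∪ K)
    have key := (s₁.mono (E' := fun x y => c x = c y) le_rfl fun _ _ _ _ _ => trivial).union
      (s₂.mono_root subset_union_left) t₁ t₂' hdis fun x hx y hy =>
        ⟨fun h' => hy.2 (h'.symm.trans hx.2), fun h' => hy.2 (h'.trans hx.2)⟩
    have tree := t₁.union t₂'
    rw [hWu] at key tree
    exact ⟨tree, key.mono (by rw [← hcard, Nat.mul_add]) fun _ _ _ _ h' => h'⟩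

/-- The subgraph of edges inside `W`. -/
def insideGraph (H : SimpleGraph V) (W : Set V) : SimpleGraph V where
  Adj x y := H.Adj x y ∧ x ∈ W ∧ y ∈ W
  symm := ⟨fun _ _ h => ⟨h.1.symm, h.2.2, h.2.1⟩⟩
  loopless := ⟨fun _ h => h.1.ne rfl⟩

theorem component_cutConnected (k : (insideGraph H W).ConnectedComponent) :
    CutConnected H {x ∈ W | (insideGraph H W).connectedComponentMk x = k} := by
  intro X hX ⟨a, ha⟩ hne
  obtain ⟨b, hb, hbX⟩ := Set.exists_of_ssubset (hX.ssubset_of_ne hne)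
  obtain ⟨p⟩ := SimpleGraph.ConnectedComponent.exact ((hX ha).2.trans hb.2.symm)
  obtain ⟨d, -, h1, h2⟩ := p.exists_boundary_dart X ha hbX
  refine ⟨d.fst, h1, d.snd, ⟨⟨d.adj.2.2, ?_⟩, h2⟩, d.adj.1⟩
  rw [← (hX h1).2]
  exact SimpleGraph.ConnectedComponent.sound d.adj.reachable.symm

theorem TwoConnectedOver.component (hD : TwoConnectedOver H S D) (hKD : K ⊆ D)
    (hPD : P ⊆ D) (hPK : Disjoint P K) (hP : P.Nonempty) (hK : CutConnected H K)
    (hatt : ∀ x ∈ K, ∀ y ∈ D, H.Adj x y → y ∈ P ∨ y ∈ K) : TwoConnectedOver H (S ∪ P) K where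
  conn := hK
  avoid X hX hXne v hv := by
    obtain ⟨x, hx, y, hy, hyv, hxy⟩ := hD.avoid X (hX.trans hKD) hXne v ⟨hKD hv.1, hv.2⟩
    refine ⟨x, hx, y, ?_, hyv, hxy⟩
    obtain hy | hy := hy
    · exact (hatt x (hX hx) y hy.1 hxy).symm.imp (fun h => ⟨h, hy.2⟩) Or.inr
    · exact Or.inr (Or.inl hy)
  root hKne := by
    obtain ⟨z, hz⟩ := hP
    obtain ⟨x, hx, y, hy, hxy⟩ := hD.conn K hKD hKne
      (fun h => hPK.le_bot ⟨hz, h ▸ hPD hz⟩)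
    exact ⟨x, hx, y, Or.inr ((hatt x hx y hy.1 hxy).resolve_right hy.2), hxy⟩

/-- A bin can be ordered with respect to a suitable vertex of the hub. -/
theorem TwoConnectedOver.exists_bin_ordering [Finite V] (hD : TwoConnectedOver H S D) (hKD : K ⊆ D)
    (hPD : P ⊆ D) (hPK : Disjoint P K) (hP : P.Nonempty) (hK : CutConnected H K)
    (hatt : ∀ x ∈ K, ∀ y ∈ D, H.Adj x y → y ∈ P ∨ y ∈ K) (t : ParentTree H S P f) :
    ∃ u ∈ P, ∃ (d g : V → V) (num : V → ℕ), ∀ v ∈ K,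
      H.Adj v (d v) ∧ (d v ∈ lowSide S P f u ∨ d v ∈ K ∧ num (d v) < num v) ∧
      H.Adj v (g v) ∧ (g v ∈ highSide P f u ∨ g v ∈ K ∧ num v < num (g v)) := by
  obtain rfl | hKne := K.eq_empty_or_nonempty
  · obtain ⟨u, hu⟩ := hP
    exact ⟨u, hu, id, id, fun _ => 0, by simp⟩
  have hK2 := hD.component hKD hPD hPK hP hK hatt
  have hends : ∃ u ∈ P, (∃ x ∈ K, ∃ y ∈ lowSide S P f u, H.Adj x y) ∧
      ∃ x ∈ K, ∃ y ∈ highSide P f u, H.Adj x y := by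
    obtain ⟨z, hz⟩ := hP
    obtain ⟨x₁, hx₁, y₁, hy₁, hxy₁⟩ := hD.conn K hKD hKne
      (fun h => hPK.le_bot ⟨hz, h ▸ hPD hz⟩)
    have hy₁P : y₁ ∈ P := (hatt x₁ hx₁ y₁ hy₁.1 hxy₁).resolve_right hy₁.2
    obtain ⟨x₂, hx₂, y₂, hy₂, hne, hxy₂⟩ := hD.avoid K hKD hKne y₁ hy₁
    have hself : ∀ u ∈ P, u ∈ highSide P f u := fun u hu =>
      ⟨hu, SimpleGraph.Reachable.refl u⟩
    obtain hy₂ | hy₂ := hy₂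
    · have hy₂P : y₂ ∈ P := (hatt x₂ hx₂ y₂ hy₂.1 hxy₂).resolve_right hy₂.2
      obtain ⟨rk, h⟩ := id t
      have low : ∀ a ∈ P, ∀ b ∈ P, a ≠ b → rk a ≤ rk b → a ∈ lowSide S P f b := by
        intro a ha b hb hab hle
        have hg : Good (parentEdge f '' (P \ {b})) S {x | x ∈ P \ {b} ∧ rk x ≤ rk b} := by
          refine good_of_rank f rk fun x hx => ⟨⟨x, hx.1, rfl⟩, ?_⟩
          refine (h x hx.1.1).2.imp id fun h' => ⟨⟨⟨h'.1, ?_⟩, by have := hx.2; omega⟩, h'.2⟩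
          rintro rfl
          have := hx.2
          omega
        exact ⟨Or.inr ha, hg a ⟨⟨ha, hab⟩, hle⟩⟩
      rcases le_total (rk y₁) (rk y₂) with hle | hle
      · exact ⟨y₂, hy₂P, ⟨x₁, hx₁, y₁, low _ hy₁P _ hy₂P hne.symm hle, hxy₁⟩,
          x₂, hx₂, y₂, hself _ hy₂P, hxy₂⟩
      · exact ⟨y₁, hy₁P, ⟨x₂, hx₂, y₂, low _ hy₂P _ hy₁P hne hle, hxy₂⟩,
          x₁, hx₁, y₁, hself _ hy₁P, hxy₁⟩
    · exact ⟨y₁, hy₁P, ⟨x₂, hx₂, y₂, ⟨Or.inl hy₂, y₂, hy₂, SimpleGraph.Reachable.refl y₂⟩, hxy₂⟩,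
        x₁, hx₁, y₁, hself _ hy₁P, hxy₁⟩
  obtain ⟨u, hu, hlow, hhigh⟩ := hends
  have hcut : ∀ {T : Set V}, (∃ x ∈ K, ∃ y ∈ T, H.Adj x y) →
      ∀ X ⊆ K, X.Nonempty → ∃ x ∈ X, ∃ y ∈ K \ X ∪ T, H.Adj x y := by
    rintro T ⟨x, hx, y, hy, hxy⟩ X hX hXne
    by_cases h : X = K
    · exact ⟨x, h ▸ hx, y, Or.inr hy, hxy⟩
    · obtain ⟨x, hx, y, hy, hxy⟩ := hK X hX hXne h
      exact ⟨x, hx, y, Or.inl hy, hxy⟩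
  refine ⟨u, hu, exists_st_ordering (hcut hhigh) (hcut hlow) fun X hX hXne v hv => ?_⟩
  obtain ⟨x, hx, y, hy, hyv, hxy⟩ := hK2.avoid X hX hXne v hv
  exact ⟨x, hx, y, hy.imp id fun h => t.subset_lowSide_union_highSide u h, hyv, hxy⟩

end Bins

section TwoConnected

variable {H : SimpleGraph V} {S P W D K : Set V} {f : V → V}

theorem highSide_congr {g : V → V} (h : ∀ v ∈ P, f v = g v) (u : V) :
    highSide P f u = highSide P g u := by
  have : parentEdge f '' (P \ {u}) = parentEdge g '' (P \ {u}) :=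
    Set.image_congr fun v hv => by simp [parentEdge, h v hv.1]
  unfold highSide
  rw [this]

theorem lowSide_congr {g : V → V} (h : ∀ v ∈ P, f v = g v) (u : V) :
    lowSide S P f u = lowSide S P g u := by
  have : parentEdge f '' (P \ {u}) = parentEdge g '' (P \ {u}) :=
    Set.image_congr fun v hv => by simp [parentEdge, h v hv.1]
  unfold lowSide
  rw [this]

theorem TwoConnectedOver.exists_hubSystem [Finite V] (hD : TwoConnectedOver H S D) (hPD : P ⊆ D)
    (hP : P.Nonempty) (t : ParentTree H S P f)
    (hcl : ∃ e ∈ H.edgeSet, ∀ w ∈ P, Good (parentEdge f '' (P \ {w}) ∪ {e}) S P) :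
    ∃ (u : (insideGraph H (D \ P)).ConnectedComponent → V) (d g : V → V) (num : V → ℕ),
      (∀ v ∈ P, d v = f v) ∧
      HubSystem H S P (D \ P) (insideGraph H (D \ P)).connectedComponentMk u d g num := by
  set c := (insideGraph H (D \ P)).connectedComponentMk
  have hK : ∀ k, ∃ u ∈ P, ∃ (d g : V → V) (num : V → ℕ), ∀ v ∈ {x ∈ D \ P | c x = k},
      H.Adj v (d v) ∧
      (d v ∈ lowSide S P f u ∨ d v ∈ {x ∈ D \ P | c x = k} ∧ num (d v) < num v) ∧
      H.Adj v (g v) ∧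
      (g v ∈ highSide P f u ∨ g v ∈ {x ∈ D \ P | c x = k} ∧ num v < num (g v)) := by
    intro k
    refine hD.exists_bin_ordering (fun x hx => hx.1.1) hPD
      (Set.disjoint_left.mpr fun x hx hx' => hx'.1.2 hx) hP (component_cutConnected k) ?_ t
    intro x hx y hy hxy
    refine or_iff_not_imp_left.mpr fun hyP => ⟨⟨hy, hyP⟩, ?_⟩
    rw [← hx.2]
    exact SimpleGraph.ConnectedComponent.sound
      (SimpleGraph.Adj.reachable (⟨hxy.symm, ⟨hy, hyP⟩, hx.1⟩ : (insideGraph H (D \ P)).Adj y x))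
  choose u hu d g num h using hK
  have hd : ∀ v ∈ P, (if v ∈ P then f v else d (c v) v) = f v := fun v hv => if_pos hv
  refine ⟨u, fun v => if v ∈ P then f v else d (c v) v,
    fun v => if v ∈ P then f v else g (c v) v, fun v => num (c v) v, hd, ?_⟩
  refine ⟨disjoint_sdiff_right, fun v hv => by simp [hv], t.congr fun v hv => (hd v hv).symm,
    ?_, hu, fun v hv => ?_, fun v hv => ?_⟩
  · obtain ⟨e, he, hg⟩ := hcl
    refine ⟨e, he, fun w hw => (hg w hw).mono (union_subset_union_left _ ?_)⟩
    rintro _ ⟨x, hx, rfl⟩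
    exact ⟨x, hx, by simp [parentEdge, hx.1]⟩
  · obtain ⟨h1, h2, -, -⟩ := h (c v) v ⟨hv, rfl⟩
    rw [lowSide_congr hd]
    simp only [hv.2, if_false]
    exact ⟨h1, h2.imp id fun h' => ⟨h'.1.1, h'.1.2, by rw [h'.1.2]; exact h'.2⟩⟩
  · obtain ⟨-, -, h1, h2⟩ := h (c v) v ⟨hv, rfl⟩
    rw [highSide_congr hd]
    simp only [hv.2, if_false]
    exact ⟨h1, h2.imp id fun h' => ⟨h'.1.1, h'.1.2, by rw [h'.1.2]; exact h'.2⟩⟩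

/-- Labels in a 2-connected part can be permuted arbitrarily in `O(n log n)` moves. -/
theorem TwoConnectedOver.exists_sortable [Finite V] [Finite ι] [DecidableEq ι]
    (hD : TwoConnectedOver H S D) : ∃ f, ParentTree H S D f ∧
      Sortable ι H S D f (fun _ _ => True) (21 * (Nat.log 2 D.ncard + 1) * D.ncard) := by
  induction hn : D.ncard using Nat.strong_induction_on generalizing S D with
  | _ n ih =>
    obtain rfl | hne := D.eq_empty_or_nonempty
    · exact ⟨id, ⟨fun _ => 0, by simp⟩, (sortable_empty (E := fun _ _ => True)).mono (by simp) (by simp)⟩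
    obtain ⟨l, hl, hbal⟩ := exists_balanced_ear hD hne
    obtain ⟨f₀, t₀, hcl⟩ := hl.exists_parentTree
    set P := {x | x ∈ l} with hPdef
    have hPD : P ⊆ D := hl.2.2.1
    have hP : P.Nonempty := List.exists_mem_of_ne_nil l hl.1
    obtain ⟨u, d, g, num, hd, hs⟩ := hD.exists_hubSystem hPD hP t₀ hcl
    set c := (insideGraph H (D \ P)).connectedComponentMk
    have hcard : P.ncard + (D \ P).ncard = n := by
      rw [← Set.ncard_union_eq disjoint_sdiff_right, union_sdiff_cancel hPD, hn]
    have hPpos := (Set.ncard_pos (s := P)).mpr hP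
    set a := 21 * Nat.log 2 n
    have hK : ∀ k, ∃ f, k ∈ c '' (D \ P) → ParentTree H (S ∪ P) {x ∈ D \ P | c x = k} f ∧
        Sortable ι H (S ∪ P) {x ∈ D \ P | c x = k} f (fun _ _ => True)
          (a * {x ∈ D \ P | c x = k}.ncard) := by
      intro k
      by_cases hk : k ∈ c '' (D \ P)
      swap
      · exact ⟨id, fun h => absurd h hk⟩
      set K := {x ∈ D \ P | c x = k} with hKdef
      have hKD : K ⊆ D := fun x hx => hx.1.1
      have hKc : CutConnected H K := component_cutConnected k
      have h2 := hbal K hKD (fun x hx hx' => hx'.1.2 hx) hKc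
      have hKpos : 0 < K.ncard := by
        obtain ⟨w, hw, hwk⟩ := hk
        exact (Set.ncard_pos (Set.toFinite _)).mpr ⟨w, hw, hwk⟩
      obtain ⟨f, tf, sf⟩ := ih K.ncard (by omega) (hD.component (K := K) hKD hPD
        (Set.disjoint_left.mpr fun x hx hx' => hx'.1.2 hx) hP hKc (by
          intro x hx y hy hxy
          refine or_iff_not_imp_left.mpr fun hyP => ⟨⟨hy, hyP⟩, ?_⟩
          rw [← hx.2]
          exact SimpleGraph.ConnectedComponent.sound (SimpleGraph.Adj.reachable
            (⟨hxy.symm, ⟨hy, hyP⟩, hx.1⟩ : (insideGraph H (D \ P)).Adj y x)))) rfl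
      refine ⟨f, fun _ => ⟨tf, sf.mono (Nat.mul_le_mul_right _ ?_) fun _ _ _ _ h => h⟩⟩
      refine Nat.mul_le_mul_left _ ?_
      have : Nat.log 2 (K.ncard * 2) = Nat.log 2 K.ncard + 1 :=
        Nat.log_mul_base (by norm_num) (by omega)
      rw [← this]
      exact Nat.log_mono_right (by omega)
    choose fK hfK using hK
    set fc : V → V := fun v => if v ∈ P then f₀ v else fK (c v) v with hfc
    have hfcK : ∀ k, ∀ x ∈ {x ∈ D \ P | c x = k}, fK k x = fc x := by
      rintro k x ⟨hx, rfl⟩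
      simp [hfc, hx.2]
    obtain ⟨tW, sW⟩ := bins_sortable (f := fc) (c := c) (W := D \ P) (S := S ∪ P) (a := a)
      fun k hk => ⟨(hfK k hk).1.congr (hfcK k), (hfK k hk).2.congr (hfcK k)⟩
    have hfcd : ∀ v ∈ P, fc v = d v := fun v hv => by simp [hfc, hv, hd v hv]
    have key := hs.sortable (E := fun _ _ => True) tW hfcd sW
    have tree := hs.canonicalTree tW hfcd
    rw [union_sdiff_cancel hPD] at key tree
    refine ⟨fc, tree, key.mono ?_ fun _ _ _ _ h => h⟩
    rw [hn]
    calc 21 * n + a * (D \ P).ncard ≤ 21 * n + a * n := by gcongr; omega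
      _ = 21 * (Nat.log 2 n + 1) * n := by ring

end TwoConnected

section Blocks

variable {G : SimpleGraph V} {W X D : Set V}

theorem sameBlock_symm {e f : Sym2 V} (h : SameBlock G e f) : SameBlock G f e :=
  h.imp Eq.symm fun ⟨v, w, hw, he, hf⟩ => ⟨v, w, hw, hf, he⟩

/-- A walk inside `W` from outside `X` into `X` passes through the cut vertex. -/
theorem mem_support_of_cut {v a x : V} (hcut : ∀ x ∈ X, ∀ y ∈ W, y ∉ X → y ≠ v → ¬ G.Adj x y)
    (p : G.Walk a x) (hp : ∀ e ∈ p.edges, ∀ z ∈ e, z ∈ W) (ha : a ∉ X) (hx : x ∈ X) :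
    v ∈ p.support := by
  obtain ⟨d, hd, h1, h2⟩ := p.exists_boundary_dart Xᶜ ha (by simpa using hx)
  have h2' : d.snd ∈ X := by simpa using h2
  have hW : d.fst ∈ W := hp d.edge (List.mem_map_of_mem hd) _ (by simp [SimpleGraph.Dart.edge])
  have : d.fst = v := by
    by_contra hne
    exact hcut _ h2' _ hW h1 hne d.adj.symm
  exact this ▸ p.dart_fst_mem_support_of_mem_darts hd

theorem cycle_avoids_cut {v c a x : V} {w : G.Walk c c} (hw : w.IsCycle)
    (hW : ∀ e ∈ w.edges, ∀ z ∈ e, z ∈ W) (hvX : v ∉ X)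
    (hcut : ∀ x ∈ X, ∀ y ∈ W, y ∉ X → y ≠ v → ¬ G.Adj x y)
    (haw : a ∈ w.support) (haX : a ∉ X) (hav : a ≠ v) (hxw : x ∈ w.support) (hx : x ∈ X) :
    False := by
  have hr := hw.rotate haw
  have hxr : x ∈ (w.rotate a haw).support := by
    rw [SimpleGraph.Walk.mem_support_rotate_iff]; exact hxw
  have hWr : ∀ e ∈ (w.rotate a haw).edges, ∀ z ∈ e, z ∈ W := fun e he =>
    hW e ((w.rotate_edges a haw).mem_iff.mp he)
  set w' := w.rotate a haw
  have hspec := w'.take_spec hxr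
  set p := w'.takeUntil x hxr
  set q := w'.dropUntil x hxr
  have hvp : v ∈ p.support := mem_support_of_cut hcut p
    (fun e he => hWr e (by rw [← hspec, SimpleGraph.Walk.edges_append]; simp [he])) haX hx
  have hvq : v ∈ q.support := by
    have := mem_support_of_cut hcut q.reverse
      (fun e he => hWr e (by
        rw [← hspec, SimpleGraph.Walk.edges_append]
        simp only [SimpleGraph.Walk.edges_reverse, List.mem_reverse] at he
        simp [he])) haX hx
    simpa using this
  have hnd := hr.support_nodup
  rw [← hspec, SimpleGraph.Walk.tail_support_append, List.nodup_append] at hnd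
  have hvp' : v ∈ p.support.tail :=
    (p.mem_support_iff.mp hvp).resolve_left (fun h => hav h.symm)
  have hvq' : v ∈ q.support.tail :=
    (q.mem_support_iff.mp hvq).resolve_left (fun h => hvX (h ▸ hx))
  exact hnd.2.2 v hvp' v hvq' rfl

/-- The edges inside `W` form a union of blocks. -/
def BlockClosed (G : SimpleGraph V) (W : Set V) : Prop :=
  ∀ e f, SameBlock G e f → (∀ x ∈ e, x ∈ W) → ∀ x ∈ f, x ∈ W

theorem BlockClosed.eqvGen (hW : BlockClosed G W) {e f : Sym2 V}
    (h : Relation.EqvGen (SameBlock G) e f) : (∀ x ∈ e, x ∈ W) ↔ ∀ x ∈ f, x ∈ W := by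
  induction h with
  | rel e f h => exact ⟨hW e f h, hW f e (sameBlock_symm h)⟩
  | refl e => rfl
  | symm e f _ ih => exact ih.symm
  | trans e f g _ _ h1 h2 => exact h1.trans h2

theorem exists_mem_ne_of_mem_edgeSet {e : Sym2 V} (he : e ∈ G.edgeSet) (v : V) :
    ∃ a ∈ e, a ≠ v := by
  induction e with
  | _ a b =>
    by_cases h : a = v
    · exact ⟨b, by simp, fun h' => G.ne_of_adj he (h.trans h'.symm)⟩
    · exact ⟨a, by simp, h⟩

theorem BlockClosed.split (hW : BlockClosed G W) {v : V} (hv : v ∈ W) (hvX : v ∉ X)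
    (hXW : X ⊆ W) (hcut : ∀ x ∈ X, ∀ y ∈ W, y ∉ X → y ≠ v → ¬ G.Adj x y) :
    BlockClosed G (W \ X) ∧ BlockClosed G (insert v X) := by
  have key : ∀ {c : V} {w : G.Walk c c} {e f : Sym2 V}, w.IsCycle → e ∈ w.edges → f ∈ w.edges →
      (∀ x ∈ e, x ∈ W) → ∀ a ∈ e, ∀ x ∈ f,
      ¬ (a ∉ X ∧ a ≠ v ∧ x ∈ X) ∧ ¬ (x ∉ X ∧ x ≠ v ∧ a ∈ X) := by
    intro c w e f hw he hf heW a ha x hx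
    have hwW : ∀ e' ∈ w.edges, ∀ z ∈ e', z ∈ W := fun e' he' =>
      hW e e' (Or.inr ⟨c, w, hw, he, he'⟩) heW
    have haw := w.mem_support_of_mem_edges he ha
    have hxw := w.mem_support_of_mem_edges hf hx
    exact ⟨fun ⟨h1, h2, h3⟩ => cycle_avoids_cut hw hwW hvX hcut haw h1 h2 hxw h3,
      fun ⟨h1, h2, h3⟩ => cycle_avoids_cut hw hwW hvX hcut hxw h1 h2 haw h3⟩
  constructor
  · rintro e f (rfl | ⟨c, w, hw, he, hf⟩) heW x hx
    · exact heW x hx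
    · refine ⟨hW e f (Or.inr ⟨c, w, hw, he, hf⟩) (fun z hz => (heW z hz).1) x hx, fun hxX => ?_⟩
      obtain ⟨a, ha, hav⟩ := exists_mem_ne_of_mem_edgeSet (w.edges_subset_edgeSet he) v
      exact (key hw he hf (fun z hz => (heW z hz).1) a ha x hx).1 ⟨(heW a ha).2, hav, hxX⟩
  · rintro e f (rfl | ⟨c, w, hw, he, hf⟩) heW x hx
    · exact heW x hx
    · have heW' : ∀ z ∈ e, z ∈ W := fun z hz => insert_subset hv hXW (heW z hz)
      by_contra hxn
      obtain ⟨a, ha, hav⟩ := exists_mem_ne_of_mem_edgeSet (w.edges_subset_edgeSet he) v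
      exact (key hw he hf heW' a ha x hx).2
        ⟨fun h => hxn (Or.inr h), fun h => hxn (Or.inl h), (heW a ha).resolve_left hav⟩

theorem exists_blockSortable [Finite V] [Finite ι] [DecidableEq ι] {r : V} (hr : r ∉ D)
    (hD : ∀ X ⊆ D, X.Nonempty → ∃ x ∈ X, ∃ y ∈ D \ X ∪ {r}, G.Adj x y)
    (hW : BlockClosed G (insert r D)) :
    ∃ f, ParentTree G {r} D f ∧ Sortable ι G {r} D f
      (fun d d' => Relation.EqvGen (SameBlock G) (parentEdge f d) (parentEdge f d'))
      (21 * (Nat.log 2 D.ncard + 1) * D.ncard) := by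
  induction hn : D.ncard using Nat.strong_induction_on generalizing D r with
  | _ n ih =>
    by_cases h2 : TwoConnectedOver G {r} D
    · obtain ⟨f, t, s⟩ := h2.exists_sortable (ι := ι)
      rw [hn] at s
      exact ⟨f, t, s.mono le_rfl fun _ _ _ _ _ => trivial⟩
    obtain ⟨X, hXD, hXne, hXneD, v, hv, hvX, hcut⟩ : ∃ X ⊆ D, X.Nonempty ∧ X ≠ D ∧
        ∃ v ∈ insert r D, v ∉ X ∧
          ∀ x ∈ X, ∀ y ∈ insert r D, y ∉ X → y ≠ v → ¬ G.Adj x y := by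
      by_contra hcon
      push Not at hcon
      refine h2 ⟨fun X hX hXne hne => ?_, fun X hX hXne v hv => ?_, fun hne => ?_⟩
      · obtain ⟨x, hx, y, hy, hyX, hyr, hxy⟩ :=
          hcon X hX hXne hne r (mem_insert r D) fun h => hr (hX h)
        exact ⟨x, hx, y, ⟨hy.resolve_left hyr, hyX⟩, hxy⟩
      · obtain ⟨x, hx, y, hy, hyX, hyr, hxy⟩ :=
          hcon X hX hXne (fun h => hv.2 (h ▸ hv.1)) v (Or.inr hv.1) hv.2
        exact ⟨x, hx, y, hy.symm.imp (fun h => ⟨h, hyX⟩) id, hyr, hxy⟩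
      · obtain ⟨x, hx, y, hy, hxy⟩ := hD D subset_rfl hne
        exact ⟨x, hx, y, hy.resolve_left fun h => h.2 h.1, hxy⟩
    have hrX : r ∉ X := fun h => hr (hXD h)
    obtain ⟨hW₁, hW₂⟩ := hW.split hv hvX (hXD.trans (subset_insert r D)) hcut
    have hsd : insert r D \ X = insert r (D \ X) := by
      ext z
      simp only [mem_sdiff, mem_insert_iff]
      constructor
      · tauto
      · rintro (rfl | h)
        · exact ⟨Or.inl rfl, hrX⟩
        · exact ⟨Or.inr h.1, h.2⟩
    rw [hsd] at hW₁
    have hcard : (D \ X).ncard + X.ncard = n := by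
      rw [← Set.ncard_union_eq disjoint_sdiff_left, sdiff_union_of_subset hXD, hn]
    have hXpos := (Set.ncard_pos (Set.toFinite X)).mpr hXne
    have hDXpos : 0 < (D \ X).ncard := by
      obtain ⟨z, hz, hzX⟩ := Set.exists_of_ssubset (hXD.ssubset_of_ne hXneD)
      exact (Set.ncard_pos (Set.toFinite _)).mpr ⟨z, hz, hzX⟩
    obtain ⟨f₁, t₁, s₁⟩ := ih (D \ X).ncard (by omega) (D := D \ X) (r := r)
      (fun h => hr h.1) (fun Y hY hYne => by
        by_cases hvY : v ∈ Y
        · obtain ⟨x, hx, y, hy, hxy⟩ :=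
            hD (Y ∪ X) (union_subset (fun z hz => (hY hz).1) hXD) hYne.inl
          have hyX : y ∉ X := fun h => by
            obtain h' | h' := hy
            · exact h'.2 (Or.inr h)
            · exact hrX (h' ▸ h)
          have hyv : y ≠ v := fun h => by
            obtain h' | h' := hy
            · exact h'.2 (Or.inl (h ▸ hvY))
            · exact hr (h' ▸ h ▸ (hY hvY).1)
          have hyW : y ∈ insert r D := hy.symm.imp id fun h => h.1
          obtain hx | hx := hx
          · exact ⟨x, hx, y, hy.imp (fun h => ⟨⟨h.1, hyX⟩, fun h' => h.2 (Or.inl h')⟩) id, hxy⟩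
          · exact absurd hxy (hcut x hx y hyW hyX hyv)
        · obtain ⟨x, hx, y, hy, hxy⟩ := hD Y (fun z hz => (hY hz).1) hYne
          refine ⟨x, hx, y, hy.imp (fun h => ⟨⟨h.1, fun hyX => ?_⟩, h.2⟩) id, hxy⟩
          exact hcut y hyX x (Or.inr (hY hx).1) (hY hx).2 (fun h => hvY (h ▸ hx)) hxy.symm)
      hW₁ rfl
    obtain ⟨f₂, t₂, s₂⟩ := ih X.ncard (by omega) (D := X) (r := v) hvX (fun Y hY hYne => by
        obtain ⟨x, hx, y, hy, hxy⟩ := hD Y (hY.trans hXD) hYne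
        refine ⟨x, hx, y, ?_, hxy⟩
        by_cases hyX : y ∈ X
        · refine Or.inl ⟨hyX, fun h => ?_⟩
          obtain h' | h' := hy
          · exact h'.2 h
          · exact hrX (h' ▸ hyX)
        · right
          by_contra hyv
          exact hcut x (hY hx) y (hy.symm.imp id fun h => h.1) hyX hyv hxy)
      hW₂ rfl
    set f : V → V := fun z => if z ∈ X then f₂ z else f₁ z with hf
    have hf₁ : ∀ z ∈ D \ X, f₁ z = f z := fun z hz => by simp [hf, hz.2]
    have hf₂ : ∀ z ∈ X, f₂ z = f z := fun z hz => by simp [hf, hz]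
    have hvs : ({v} : Set V) ⊆ {r} ∪ D \ X := by
      rintro z rfl
      exact hv.imp id fun h => ⟨h, hvX⟩
    have t₁' := t₁.congr hf₁
    have t₂' := (t₂.congr hf₂).mono hvs
    have s₁' := (s₁.congr hf₁).mono (E' := fun d d' =>
      Relation.EqvGen (SameBlock G) (parentEdge f d) (parentEdge f d')) le_rfl
      fun x hx y hy h => by simpa only [parentEdge, hf₁ x hx, hf₁ y hy] using h
    have s₂' := ((s₂.congr hf₂).mono_root hvs).mono (E' := fun d d' =>
      Relation.EqvGen (SameBlock G) (parentEdge f d) (parentEdge f d')) le_rfl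
      fun x hx y hy h => by simpa only [parentEdge, hf₂ x hx, hf₂ y hy] using h
    have hsep : ∀ x ∈ D \ X, ∀ y ∈ X,
        ¬ Relation.EqvGen (SameBlock G) (parentEdge f x) (parentEdge f y) := by
      intro x hx y hy h
      have hin : ∀ z ∈ parentEdge f x, z ∈ insert r (D \ X) := by
        intro z hz
        obtain rfl | rfl := Sym2.mem_iff.mp hz
        · exact Or.inr hx
        · exact t₁'.mem hx
      have := (hW₁.eqvGen h).mp hin y (Sym2.mem_mk_left _ _)
      exact this.elim (fun h => hrX (h ▸ hy)) fun h => h.2 hy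
    have key := s₁'.union s₂' t₁' t₂' disjoint_sdiff_left fun x hx y hy =>
      ⟨hsep x hx y hy, fun h => hsep x hx y hy h.symm⟩
    have tree := t₁'.union t₂'
    rw [sdiff_union_of_subset hXD] at key tree
    refine ⟨f, tree, key.mono ?_ fun _ _ _ _ h => h⟩
    have l₁ : Nat.log 2 (D \ X).ncard ≤ Nat.log 2 n := Nat.log_mono_right (by omega)
    have l₂ : Nat.log 2 X.ncard ≤ Nat.log 2 n := Nat.log_mono_right (by omega)
    calc _ ≤ 21 * (Nat.log 2 n + 1) * (D \ X).ncard + 21 * (Nat.log 2 n + 1) * X.ncard := by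
          gcongr
      _ = 21 * (Nat.log 2 n + 1) * n := by rw [← Nat.mul_add, hcard]

end Blocks

section Assembly

variable {G : SimpleGraph V}

theorem connected_of_good {E : Set (Sym2 V)} {r : V} (h : Good E {r} {r}ᶜ) :
    (SimpleGraph.fromEdgeSet E).Connected := by
  rw [SimpleGraph.connected_iff_exists_forall_reachable]
  refine ⟨r, fun w => ?_⟩
  by_cases hw : w = r
  · rw [hw]
  · obtain ⟨s, rfl, hs⟩ := h w hw
    exact hs.symm

variable [Fintype V] {b c : Fin (Fintype.card V - 1) → Sym2 V}

theorem tree_of_connected (h : (SimpleGraph.fromEdgeSet (range c)).Connected) :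
    Injective c ∧ (SimpleGraph.fromEdgeSet (range c)).IsTree := by
  have : Nonempty V := h.nonempty
  have hV : 0 < Fintype.card V := Fintype.card_pos
  have h1 := h.card_vert_le_card_edgeSet_add_one
  have h2 : (SimpleGraph.fromEdgeSet (range c)).edgeSet ⊆ range c := by
    rw [SimpleGraph.edgeSet_fromEdgeSet]; exact sdiff_subset
  have h3 : Nat.card (SimpleGraph.fromEdgeSet (range c)).edgeSet ≤ (range c).ncard :=
    Set.ncard_le_ncard h2 (Set.toFinite _)
  have h4 : (range c).ncard ≤ Fintype.card V - 1 := by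
    rw [← image_univ]
    exact (Set.ncard_image_le (Set.toFinite _)).trans (by simp)
  rw [Nat.card_eq_fintype_card (α := V)] at h1
  refine ⟨injOn_univ.mp (Set.injOn_of_ncard_image_eq ?_), ?_⟩
  · rw [image_univ, Set.ncard_univ, Nat.card_fin]; omega
  · rw [SimpleGraph.isTree_iff_connected_and_card, Nat.card_eq_fintype_card (α := V)]
    exact ⟨h, by omega⟩

/-- Replacing an edge of a spanning tree either does nothing or brings in a new edge from the
same block. -/
theorem sameBlock_of_update {i : Fin (Fintype.card V - 1)} {e : Sym2 V}
    (hcG : ∀ j, c j ∈ G.edgeSet) (he : e ∈ G.edgeSet)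
    (hc : (SimpleGraph.fromEdgeSet (range c)).Connected)
    (hc' : (SimpleGraph.fromEdgeSet (range (update c i e))).Connected) (hne : e ≠ c i) :
    e ∉ range c ∧ SameBlock G (c i) e := by
  obtain ⟨hinj, htree⟩ := tree_of_connected hc'
  have hmem : e ∉ range c := by
    rintro ⟨j, rfl⟩
    have hji : j ≠ i := fun h => hne (h ▸ rfl)
    exact hji (hinj (by simp [hji]))
  refine ⟨hmem, Or.inr ?_⟩
  induction e with
  | _ x y =>
    obtain ⟨p, hp⟩ := hc.exists_isPath y x
    have hpc : ∀ e' ∈ p.edges, e' ∈ range c := fun e' he' => by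
      have := p.edges_subset_edgeSet he'
      rw [SimpleGraph.edgeSet_fromEdgeSet] at this
      exact this.1
    have hxy : s(x, y) ∉ p.edges := fun h => hmem (hpc _ h)
    have hpG : ∀ e' ∈ p.edges, e' ∈ G.edgeSet := fun e' he' => by
      obtain ⟨j, rfl⟩ := hpc e' he'
      exact hcG j
    have hadjG : G.Adj x y := he
    refine ⟨x, .cons hadjG (p.transfer G hpG), ?_, ?_, by simp⟩
    · rw [SimpleGraph.Walk.cons_isCycle_iff, SimpleGraph.Walk.edges_transfer]
      exact ⟨hp.transfer hpG, hxy⟩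
    · rw [SimpleGraph.Walk.edges_cons, SimpleGraph.Walk.edges_transfer]
      refine List.mem_cons_of_mem _ ?_
      by_contra hci
      have hpT : ∀ e' ∈ p.edges,
          e' ∈ (SimpleGraph.fromEdgeSet (range (update c i s(x, y)))).edgeSet := by
        intro e' he'
        obtain ⟨j, rfl⟩ := hpc e' he'
        have hji : j ≠ i := fun h => hci (h ▸ he')
        rw [SimpleGraph.edgeSet_fromEdgeSet]
        exact ⟨⟨j, by simp [hji]⟩, G.not_isDiag_of_mem_edgeSet (hcG j)⟩
      have hadj : (SimpleGraph.fromEdgeSet (range (update c i s(x, y)))).Adj x y := by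
        rw [SimpleGraph.fromEdgeSet_adj]
        exact ⟨⟨i, by simp⟩, G.ne_of_adj he⟩
      refine htree.isAcyclic (.cons hadj (p.transfer _ hpT)) ?_
      rw [SimpleGraph.Walk.cons_isCycle_iff, SimpleGraph.Walk.edges_transfer]
      exact ⟨hp.transfer hpT, hxy⟩

theorem eqvGen_of_reach {r : V} {k : ℕ} {b₀ : Fin (Fintype.card V - 1) → Sym2 V}
    (h : Reach (LocalValid G {r} {r}ᶜ univ b₀) k b c) (i : Fin (Fintype.card V - 1)) :
    Relation.EqvGen (SameBlock G) (b i) (c i) := by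
  induction h with
  | refl => exact .refl _
  | step k b c j e h hv ih =>
    refine ih.trans _ _ _ ?_
    by_cases hij : i = j
    · subst hij
      by_cases hne : e = c i
      · rw [hne, update_eq_self]; exact .refl _
      · have hc := h.valid_right
        have hg := hc.good
        have hg' := hv.good
        rw [image_univ] at hg hg'
        have he := hv.edge i (mem_univ i)
        rw [update_self] at he ⊢
        exact .rel _ _ (sameBlock_of_update (fun j => hc.edge j (mem_univ j)) he
          (connected_of_good hg) (connected_of_good hg') hne).2
    · rw [update_of_ne hij]; exact .refl _

theorem stepsIn_succ_right {X : Type*} {R : X → X → Prop} {n : ℕ} {x y z : X}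
    (h : StepsIn R n x y) (hyz : R y z) : StepsIn R (n + 1) x z := by
  induction n generalizing x with
  | zero => exact ⟨z, h ▸ hyz, rfl⟩
  | succ n ih =>
    obtain ⟨w, hw, hn⟩ := h
    exact ⟨w, hw, ih hn⟩

theorem exists_stepsIn_of_reach {r : V} {k : ℕ} {b₀ : Fin (Fintype.card V - 1) → Sym2 V}
    (h : Reach (LocalValid G {r} {r}ᶜ univ b₀) k b c) :
    ∃ n ≤ k, StepsIn (TreeStep G) n b c := by
  induction h with
  | refl => exact ⟨0, Nat.zero_le _, rfl⟩
  | step k b c i e h hv ih =>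
    obtain ⟨n, hn, hs⟩ := ih
    by_cases hne : e = c i
    · rw [hne, update_eq_self]; exact ⟨n, hn.trans (Nat.le_succ k), hs⟩
    · have hc := h.valid_right
      have hg := hc.good
      have hg' := hv.good
      rw [image_univ] at hg hg'
      have he := hv.edge i (mem_univ i)
      rw [update_self] at he
      refine ⟨n + 1, Nat.succ_le_succ hn, stepsIn_succ_right hs ⟨i, e, he,
        (sameBlock_of_update (fun j => hc.edge j (mem_univ j)) he
          (connected_of_good hg) (connected_of_good hg') hne).1, ⟨?_, ?_⟩, rfl⟩⟩
      · rintro _ ⟨j, rfl⟩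
        exact hv.edge j (mem_univ j)
      · exact (tree_of_connected (connected_of_good hg')).2

/-- A labelled spanning tree rooted at `r` is given by parent pointers and a placement of the
labels at the other vertices. -/
theorem exists_cfg_of_isLabelledSpanningTree (h : IsLabelledSpanningTree G b) (r : V)
    (b₀ : Fin (Fintype.card V - 1) → Sym2 V) :
    ∃ f p, ParentTree G {r} {r}ᶜ f ∧ BijOn p univ {r}ᶜ ∧
      b = cfg univ b₀ p (parentEdge f) := by
  obtain ⟨-, hbG, htree⟩ := h
  set T := SimpleGraph.fromEdgeSet (range b) with hT
  have hpar : ∀ d, ∃ z, d ≠ r → T.Adj d z ∧ T.dist z r < T.dist d r := by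
    intro d
    obtain ⟨p, hp⟩ := htree.connected.exists_walk_length_eq_dist d r
    cases p with
    | nil => exact ⟨r, fun h => absurd rfl h⟩
    | cons hadj q =>
      refine ⟨_, fun _ => ⟨hadj, ?_⟩⟩
      rw [← hp, SimpleGraph.Walk.length_cons]
      exact Nat.lt_succ_of_le (SimpleGraph.dist_le q)
  choose f hf using hpar
  have hmem : ∀ d ∈ ({r}ᶜ : Set V), parentEdge f d ∈ range b := fun d hd =>
    (SimpleGraph.fromEdgeSet_adj _ |>.mp (hf d hd).1).1
  have hinj : InjOn (parentEdge f) {r}ᶜ := by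
    intro d hd d' hd' heq
    obtain ⟨h1, -⟩ | ⟨h1, h2⟩ := Sym2.eq_iff.mp heq
    · exact h1
    · have l1 := (hf d hd).2
      have l2 := (hf d' hd').2
      rw [h2] at l1
      rw [← h1] at l2
      omega
  have hcard : Fintype.card ({r}ᶜ : Set V) = Fintype.card (Fin (Fintype.card V - 1)) := by
    rw [Fintype.card_compl_set, Fintype.card_fin]; simp
  choose l hl using fun d : ({r}ᶜ : Set V) => hmem d d.2
  have hlinj : Injective l := fun d d' hdd =>
    Subtype.ext (hinj d.2 d'.2 ((hl d).symm.trans ((congrArg b hdd).trans (hl d'))))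
  have hlbij : Bijective l := (Fintype.bijective_iff_injective_and_card l).mpr ⟨hlinj, hcard⟩
  set e := Equiv.ofBijective l hlbij
  refine ⟨f, fun i => e.symm i, ⟨fun d => T.dist d r, fun d hd => ⟨?_, ?_⟩⟩,
    ⟨fun i _ => (e.symm i).2, fun i _ j _ hij => e.symm.injective (Subtype.ext hij),
      fun d hd => ⟨e ⟨d, hd⟩, mem_univ _, by simp⟩⟩, ?_⟩
  · exact hbG (hmem d hd)
  · by_cases h : f d = r
    · exact Or.inl h
    · exact Or.inr ⟨h, (hf d hd).2⟩
  · funext i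
    rw [cfg, if_pos (mem_univ i), ← hl (e.symm i)]
    exact congrArg b (e.apply_symm_apply i).symm

end Assembly

end

end TreeReconfiguration

/-- There is an absolute constant `c` such that whenever the
reconfiguration condition holds (each label's two edges share a 2-connected component),
one labelled spanning tree can be reconfigured to the other in at most `c·n·log n` basis
exchange steps. -/
theorem labelled_spanning_tree_reconfiguration_nlogn :
    ∃ c : ℕ, ∀ (V : Type u) [Fintype V] (G : SimpleGraph V), G.Connected →
      ∀ b₁ b₂ : Fin (Fintype.card V - 1) → Sym2 V,
        IsLabelledSpanningTree G b₁ → IsLabelledSpanningTree G b₂ →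
        (∀ i, SameBlock G (b₁ i) (b₂ i)) →
        ∃ n, n ≤ c * (Fintype.card V * Nat.log 2 (Fintype.card V)) ∧
          StepsIn (TreeStep G) n b₁ b₂ := by
  refine ⟨44, fun V _ G hG b₁ b₂ h₁ h₂ hb => ?_⟩
  obtain ⟨r⟩ := hG.nonempty
  obtain ⟨f₁, p₁, t₁, hp₁, e₁⟩ :=
    TreeReconfiguration.exists_cfg_of_isLabelledSpanningTree h₁ r b₁
  obtain ⟨f₂, p₂, t₂, hp₂, e₂⟩ :=
    TreeReconfiguration.exists_cfg_of_isLabelledSpanningTree h₂ r b₁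
  have hr : insert r ({r}ᶜ : Set V) = univ := by
    ext z; simp [em]
  obtain ⟨f, t, s⟩ := TreeReconfiguration.exists_blockSortable (G := G)
    (ι := Fin (Fintype.card V - 1)) (D := {r}ᶜ) (r := r) (by simp) (fun X hX hXne => by
      obtain ⟨x, hx⟩ := hXne
      obtain ⟨p⟩ := hG.preconnected x r
      obtain ⟨d, -, h1, h2⟩ := p.exists_boundary_dart X hx fun h => hX h rfl
      refine ⟨d.fst, h1, d.snd, ?_, d.adj⟩
      by_cases h : d.snd = r
      · exact Or.inr h
      · exact Or.inl ⟨h, h2⟩) (fun _ _ _ _ _ _ => by rw [hr]; trivial)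
  have r₁ := t₁.reach_switch t (b := b₁) hp₁
  have r₂ := t.reach_switch t₂ (b := b₁) hp₂
  rw [← e₁] at r₁
  rw [← e₂] at r₂
  have key := s univ b₁ p₁ p₂ hp₁ hp₂ fun i _ => by
    have q₁ := TreeReconfiguration.eqvGen_of_reach r₁ i
    have q₂ := TreeReconfiguration.eqvGen_of_reach r₂ i
    simp only [TreeReconfiguration.cfg, mem_univ, if_true] at q₁ q₂
    exact (q₁.symm _ _).trans _ _ _ ((Relation.EqvGen.rel _ _ (hb i)).trans _ _ _ (q₂.symm _ _))
  obtain ⟨n, hn, hs⟩ := TreeReconfiguration.exists_stepsIn_of_reach ((r₁.trans key).trans r₂)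
  refine ⟨n, hn.trans ?_, hs⟩
  have hD : ({r}ᶜ : Set V).ncard + 1 = Fintype.card V := by
    have := Set.ncard_add_ncard_compl ({r} : Set V)
    rw [Set.ncard_singleton, Nat.card_eq_fintype_card] at this
    omega
  set m := ({r}ᶜ : Set V).ncard
  rw [← hD]
  obtain hm | hm := Nat.eq_zero_or_pos m
  · simp [hm]
  have hlog : Nat.log 2 m ≤ Nat.log 2 (m + 1) := Nat.log_mono_right (Nat.le_succ m)
  have hlog' : 1 ≤ Nat.log 2 (m + 1) := Nat.log_pos one_lt_two (by omega)
  calc m + 21 * (Nat.log 2 m + 1) * m + m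
      = (2 + 21 * (Nat.log 2 m + 1)) * m := by ring
    _ ≤ (44 * Nat.log 2 (m + 1)) * (m + 1) :=
        Nat.mul_le_mul (by omega) (Nat.le_succ m)
    _ = 44 * ((m + 1) * Nat.log 2 (m + 1)) := by ring
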